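/- Let G = G_1 * G_2 * ... * G_n * F be a finitely generated residually finite group, where each factor G_i is not infinite cyclic and F is a free group of finite rank. If φ is a symmetric endomorphism of G, then the fixed subgroup Fix(φ) = {g ∈ G : φ(g) = g} has Kurosh rank at most n + rank(F) with respect to this free product decomposition of G. -/

import Mathlib

universe u

open Monoid

instance sumElimGroup {α β : Type*} (A : α → Type u) (B : β → Type u)
    [∀ a, Group (A a)] [∀ b, Group (B b)] (x : α ⊕ β) : Group (Sum.elim A B x) :=
  match x with
  | .inl a => inferInstanceAs (Group (A a))
  | .inr b => inferInstanceAs (Group (B b))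

/-- The free factor `G_i` of a free product, viewed as a subgroup. -/
def factorSubgroup {ι : Type*} {M : ι → Type*} [∀ i, Group (M i)] (i : ι) :
    Subgroup (CoprodI M) := (CoprodI.of (i := i)).range

/-- The conjugate `g S g⁻¹` of a subgroup `S`. -/
def conjSubgroup {G : Type*} [Group G] (g : G) (S : Subgroup G) : Subgroup G :=
  S.map (MulAut.conj g).toMonoidHom

/-- The `n`-th iterate of an endomorphism. -/
def iterHom {G : Type*} [Group G] (φ : G →* G) : ℕ → (G →* G)
  | 0 => MonoidHom.id G
  | n + 1 => φ.comp (iterHom φ n)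

/-- The stable image `φ^∞(G) = ⋂ₙ φⁿ(G)`. -/
def stableImage {G : Type*} [Group G] (φ : G →* G) : Subgroup G :=
  ⨅ n : ℕ, (iterHom φ (n + 1)).range

/-- The fixed subgroup of an endomorphism. -/
def fixedSubgroup {G : Type*} [Group G] (φ : G →* G) : Subgroup G where
  carrier := {g | φ g = g}
  one_mem' := by simp
  mul_mem' := by intro a b ha hb; simp only [Set.mem_setOf_eq, map_mul] at *; rw [ha, hb]
  inv_mem' := by intro a ha; simp only [Set.mem_setOf_eq, map_inv] at *; rw [ha]

/-- `H` has Kurosh rank at most `k` with respect to the given splitting. -/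
def HasKuroshRankLE {ι : Type} {M : ι → Type} [∀ i, Group (M i)]
    (H : Subgroup (CoprodI M)) (k : ℕ) : Prop :=
  ∃ (m r : ℕ) (J : Fin m → ι) (g : Fin m → CoprodI M)
    (e : H ≃* CoprodI (Sum.elim
      (fun i : Fin m => ↥(conjSubgroup (g i) (factorSubgroup (J i)) ⊓ H))
      (fun _ : Fin r => Multiplicative ℤ))),
    m + r ≤ k ∧
    (∀ i : Fin m, Nontrivial ↥(conjSubgroup (g i) (factorSubgroup (J i)) ⊓ H)) ∧
    ∀ (i : Fin m) (x : ↥(conjSubgroup (g i) (factorSubgroup (J i)) ⊓ H)),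
      ((e.symm (CoprodI.of (i := Sum.inl i) x) : H) : CoprodI M) = (x : CoprodI M)

/-- A homomorphism between free products is *symmetric* if each non-infinite-cyclic free
factor of the domain is mapped into a conjugate of some non-infinite-cyclic free factor of
the codomain. -/
def IsSymmetric {ι κ : Type} {M : ι → Type} {N : κ → Type}
    [∀ i, Group (M i)] [∀ j, Group (N j)]
    (φ : Monoid.CoprodI M →* Monoid.CoprodI N) : Prop :=
  ∀ i : ι, ¬ Nonempty (M i ≃* Multiplicative ℤ) →
    ∃ (j : κ) (g : Monoid.CoprodI N), ¬ Nonempty (N j ≃* Multiplicative ℤ) ∧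
      (factorSubgroup i).map φ ≤ conjSubgroup g (factorSubgroup j)

/-- A group is residually finite if every nontrivial element survives in some finite
quotient. -/
def ResiduallyFinite (G : Type*) [Group G] : Prop :=
  ∀ g : G, g ≠ 1 → ∃ (Γ : Type) (_ : Group Γ) (_ : Finite Γ) (π : G →* Γ), π g ≠ 1

/-- `H` is the free product of the subgroups `A i` and of a free group with basis `y`, stated
through the universal property. -/
structure IsFreeSplitting {H : Type} [Group H] {I K : Type} (A : I → Subgroup H) (y : K → H) :
    Prop where
  gen : ∀ S : Subgroup H, (∀ i, A i ≤ S) → (∀ k, y k ∈ S) → S = ⊤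
  extend : ∀ (L : Type) [Group L] (f : ∀ i, A i →* L) (z : K → L),
    ∃ Φ : H →* L, (∀ i (a : A i), Φ a = f i a) ∧ ∀ k, Φ (y k) = z k

/-- The homomorphism out of a free product of the groups `A a` and of a free group. -/
def liftSum {α β : Type} {A : α → Type} [∀ a, Group (A a)] {L : Type} [Group L]
    (f : ∀ a, A a →* L) (z : β → L) :
    CoprodI (Sum.elim A fun _ : β => Multiplicative ℤ) →* L :=
  CoprodI.lift fun x => match x with
    | .inl a => f a
    | .inr b => zpowersHom L (z b)

section liftSum
variable {α β : Type} {A : α → Type} [∀ a, Group (A a)] {L : Type} [Group L]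
    (f : ∀ a, A a →* L) (z : β → L)

/-- The inclusion of a factor. -/
def inlHom (A : α → Type) [∀ a, Group (A a)] (β : Type) (a : α) :
    A a →* CoprodI (Sum.elim A fun _ : β => Multiplicative ℤ) :=
  CoprodI.of (M := Sum.elim A fun _ : β => Multiplicative ℤ) (i := Sum.inl a)

/-- The free generators. -/
def inrGen (A : α → Type) [∀ a, Group (A a)] {β : Type} (b : β) :
    CoprodI (Sum.elim A fun _ : β => Multiplicative ℤ) :=
  CoprodI.of (M := Sum.elim A fun _ : β => Multiplicative ℤ) (i := Sum.inr b)
    (Multiplicative.ofAdd (1 : ℤ))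

theorem liftSum_inlHom (a : α) (x : A a) : liftSum f z (inlHom A β a x) = f a x :=
  CoprodI.lift_of _ _

theorem liftSum_inrGen (b : β) : liftSum f z (inrGen A b) = z b := by
  refine (CoprodI.lift_of _ _).trans ?_
  exact (zpowersHom_apply L (z b) _).trans (zpow_one _)

theorem coprod_gen (S : Subgroup (CoprodI (Sum.elim A fun _ : β => Multiplicative ℤ)))
    (h1 : ∀ a x, inlHom A β a x ∈ S) (h2 : ∀ b, inrGen A b ∈ S) : S = ⊤ := by
  rw [eq_top_iff]
  rintro x -
  induction x using CoprodI.induction_on with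
  | one => exact S.one_mem
  | of i m =>
    match i, m with
    | .inl a, m => exact h1 a m
    | .inr b, m =>
      have : (CoprodI.of (M := Sum.elim A fun _ : β => Multiplicative ℤ) (i := Sum.inr b) m)
          = inrGen A b ^ (Multiplicative.toAdd (show Multiplicative ℤ from m)) := by
        refine Eq.trans ?_ (map_zpow (CoprodI.of (M := Sum.elim A fun _ : β => Multiplicative ℤ)
          (i := Sum.inr b)) (Multiplicative.ofAdd (1 : ℤ)) _)
        congr 1
        change (show Multiplicative ℤ from m) = (Multiplicative.ofAdd (1 : ℤ)) ^ (_ : ℤ)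
        rw [← ofAdd_zsmul]; simp; rfl
      rw [this]; exact S.zpow_mem (h2 b) _
  | mul x y hx hy => exact S.mul_mem hx hy

theorem isFreeSplitting_coprod :
    IsFreeSplitting (fun a : α => factorSubgroup
      (M := Sum.elim A fun _ : β => Multiplicative ℤ) (Sum.inl a))
      (fun b : β => inrGen A b) where
  gen S h1 h2 := coprod_gen S (fun a x => h1 a ⟨x, rfl⟩) h2
  extend L _ f z := by
    refine ⟨liftSum (fun a => (f a).comp (MonoidHom.rangeRestrict (inlHom A β a))) z, ?_, ?_⟩
    · rintro a ⟨_, x, rfl⟩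
      exact liftSum_inlHom _ _ _ _
    · intro k; exact liftSum_inrGen _ _ _

end liftSum

/-- A free splitting gives an isomorphism with the free product. -/
theorem IsFreeSplitting.exists_mulEquiv {H : Type} [Group H] {I K : Type} {A : I → Subgroup H}
    {y : K → H} (hs : IsFreeSplitting A y) {A' : I → Type} [∀ i, Group (A' i)]
    (t : ∀ i, A' i ≃* A i) :
    ∃ e : H ≃* CoprodI (Sum.elim A' fun _ : K => Multiplicative ℤ),
      ∀ i x, e.symm (inlHom A' K i x) = t i x := by
  obtain ⟨Φ, h1, h2⟩ := hs.extend (CoprodI (Sum.elim A' fun _ : K => Multiplicative ℤ))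
    (fun i => (inlHom A' K i).comp (t i).symm.toMonoidHom) (fun k => inrGen A' k)
  let Ψ := liftSum (fun i => (A i).subtype.comp (t i).toMonoidHom) y
  have e1 : ∀ x, Ψ (Φ x) = x := by
    have := hs.gen ((Ψ.comp Φ).eqLocus (MonoidHom.id H)) ?_ ?_
    · intro x; exact (this ▸ Subgroup.mem_top x : x ∈ (Ψ.comp Φ).eqLocus (MonoidHom.id H))
    · intro i a ha
      change Ψ (Φ a) = a
      have := h1 i ⟨a, ha⟩
      simp only at this
      rw [this]
      simp [Ψ, liftSum_inlHom]
    · intro k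
      change Ψ (Φ (y k)) = y k
      rw [h2, liftSum_inrGen]
  have e2 : ∀ x, Φ (Ψ x) = x := by
    have := coprod_gen ((Φ.comp Ψ).eqLocus (MonoidHom.id _)) ?_ ?_
    · intro x; exact (this ▸ Subgroup.mem_top x : x ∈ (Φ.comp Ψ).eqLocus (MonoidHom.id _))
    · intro i a
      change Φ (Ψ _) = _
      rw [liftSum_inlHom]
      simp [h1]
    · intro k
      change Φ (Ψ _) = _
      rw [liftSum_inrGen, h2]; rfl
  refine ⟨MonoidHom.toMulEquiv Φ Ψ (MonoidHom.ext e1) (MonoidHom.ext e2), fun i x => ?_⟩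
  exact (liftSum_inlHom (fun i => (A i).subtype.comp (t i).toMonoidHom) y i x).trans rfl

/-- Orbit counting: a function with finite support, invariant under an injection acting on the
support without fixed points and with `q`-power order, has sum divisible by `q`. -/
theorem prime_dvd_sum_of_orbits {X : Type} {q : ℕ} (hq : q.Prime) (σ : X → X)
    (f : X →₀ ℤ) (hf : ∀ x, f (σ x) = f x)
    (hfix : ∀ x, f x ≠ 0 → σ x ≠ x) (a : ℕ) (hper : ∀ x, f x ≠ 0 → σ^[q ^ a] x = x) :
    (q : ℤ) ∣ f.sum fun _ c => c := by
  classical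
  have : Fact q.Prime := ⟨hq⟩
  rw [Finsupp.sum, ← Finset.sum_fiberwise_of_maps_to (t := f.support.image f) (g := f)
    (fun i hi => Finset.mem_image_of_mem _ hi)]
  refine Finset.dvd_sum fun c hc => ?_
  have hc0 : c ≠ 0 := by
    obtain ⟨x, hx, rfl⟩ := Finset.mem_image.1 hc
    exact Finsupp.mem_support_iff.1 hx
  rw [Finset.sum_congr rfl (fun x hx => (Finset.mem_filter.1 hx).2), Finset.sum_const,
    nsmul_eq_mul]
  refine Dvd.dvd.mul_right ?_ c
  set Y : Finset X := {x ∈ f.support | f x = c} with hY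
  have hm : ∀ x, x ∈ Y ↔ f x = c := fun x => by
    simp only [hY, Finset.mem_filter, Finsupp.mem_support_iff]
    exact ⟨fun h => h.2, fun h => ⟨h ▸ hc0, h⟩⟩
  let g : Function.End Y := fun x => ⟨σ x, (hm _).2 ((hf _).trans ((hm _).1 x.2))⟩
  have hg : g ^ q ^ a = 1 := by
    have : ∀ k (x : Y), (((g ^ k : Function.End Y) x : Y) : X) = σ^[k] x := by
      intro k
      induction k with
      | zero => intro x; rfl
      | succ k ih =>
        intro x
        rw [pow_succ', Function.iterate_succ_apply', ← ih]; rfl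
    funext x
    apply Subtype.ext
    rw [this]
    exact hper _ (by rw [(hm _).1 x.2]; exact hc0)
  have h1 := Equiv.Perm.card_fixedPoints_modEq hg
  have h2 : IsEmpty g.fixedPoints := ⟨fun ⟨x, hx⟩ =>
    hfix x (by rw [(hm _).1 x.2]; exact hc0) (congrArg Subtype.val hx)⟩
  have h3 : Fintype.card g.fixedPoints = 0 := Fintype.card_eq_zero_iff.2 h2
  replace h1 := h1.trans (congrArg (· % q) h3)
  rw [Fintype.card_coe] at h1
  exact_mod_cast (Nat.modEq_zero_iff_dvd.1 h1)

theorem IsFreeSplitting.induction {H : Type} [Group H] {I K : Type} {A : I → Subgroup H}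
    {y : K → H} (hs : IsFreeSplitting A y) {p : H → Prop} (one : p 1)
    (mul : ∀ g h, p g → p h → p (g * h)) (inv : ∀ g, p g → p g⁻¹)
    (fac : ∀ i, ∀ a ∈ A i, p a) (free : ∀ k, p (y k)) (h : H) : p h := by
  have := hs.gen { carrier := {h | p h}, one_mem' := one, mul_mem' := mul _ _, inv_mem' := inv _ }
    fac free
  exact (this ▸ Subgroup.mem_top h : h ∈ (_ : Subgroup H))

section Shift
variable {H : Type} [Group H] {S : Type}

/-- Left translation on `ℤ[H]^S`. -/
noncomputable def shiftF (h : H) : (H × S →₀ ℤ) →+ (H × S →₀ ℤ) :=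
  Finsupp.mapDomain.addMonoidHom fun p => (h * p.1, p.2)

theorem shiftF_single (h : H) (p : H × S) (c : ℤ) :
    shiftF h (Finsupp.single p c) = Finsupp.single (h * p.1, p.2) c :=
  Finsupp.mapDomain_single

theorem shiftF_one (d : H × S →₀ ℤ) : shiftF 1 d = d := by
  have : (fun p : H × S => ((1 : H) * p.1, p.2)) = id := by ext <;> simp
  change Finsupp.mapDomain _ d = d
  rw [this, Finsupp.mapDomain_id]

theorem shiftF_mul (g h : H) (d : H × S →₀ ℤ) : shiftF (g * h) d = shiftF g (shiftF h d) := by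
  change Finsupp.mapDomain _ d = Finsupp.mapDomain _ (Finsupp.mapDomain _ d)
  rw [← Finsupp.mapDomain_comp]
  congr 1
  funext p
  simp [mul_assoc]

theorem shiftF_apply (h : H) (d : H × S →₀ ℤ) (g : H) (s : S) :
    shiftF h d (g, s) = d (h⁻¹ * g, s) := by
  have hi : Function.Injective (fun p : H × S => (h * p.1, p.2)) := by
    rintro ⟨a, s⟩ ⟨b, t⟩ hab; simpa using hab
  have := Finsupp.mapDomain_apply hi d (h⁻¹ * g, s)
  simp only [mul_inv_cancel_left] at this
  exact this

variable {X : Type} [MulAction H X]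

/-- The boundary map of the graph with oriented edges `(h, s)` from `h • o` to `h • e s`. -/
noncomputable def bd (o : X) (e : S → X) : (H × S →₀ ℤ) →+ (X →₀ ℤ) :=
  Finsupp.mapDomain.addMonoidHom (fun p => p.1 • e p.2) -
    Finsupp.mapDomain.addMonoidHom (fun p => p.1 • o)

theorem bd_single (o : X) (e : S → X) (p : H × S) (c : ℤ) :
    bd o e (Finsupp.single p c) =
      Finsupp.single (p.1 • e p.2) c - Finsupp.single (p.1 • o) c := by
  simp [bd, Finsupp.mapDomain_single]

theorem bd_shiftF (o : X) (e : S → X) (h : H) (d : H × S →₀ ℤ) :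
    bd o e (shiftF h d) = Finsupp.mapDomain (h • ·) (bd o e d) := by
  induction d using Finsupp.induction_linear with
  | zero => simp
  | add f g hf hg => rw [map_add, map_add, map_add, hf, hg, Finsupp.mapDomain_add]
  | single p c =>
    rw [shiftF_single, bd_single, bd_single, Finsupp.mapDomain_sub, Finsupp.mapDomain_single,
      Finsupp.mapDomain_single]
    simp [mul_smul]

/-- A function `D` assigning to each vertex `x` a finite chain of edges joining `o` to `x`
(when `x` lies in `Y`), in an equivariant manner. -/
structure IsPathCocycle (o : X) (e : S → X) (Y : Set X) (D : X → (H × S →₀ ℤ)) : Prop where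
  coc : ∀ (h : H) x, D (h • x) = D (h • o) + shiftF h (D x)
  base : ∀ s, D (e s) = Finsupp.single (1, s) 1
  bdry : ∀ x ∈ Y, bd o e (D x) = Finsupp.single x 1 - Finsupp.single o 1

end Shift

section Construct
variable {H : Type} [Group H] {I K : Type} {A : I → Subgroup H} {y : K → H}

theorem IsFreeSplitting.exists_crossedHom (hs : IsFreeSplitting A y) :
    ∃ c : H → (H × (I ⊕ K) →₀ ℤ), (∀ g h, c (g * h) = c g + shiftF g (c h)) ∧
      (∀ i, ∀ a ∈ A i, c a + shiftF a (Finsupp.single (1, Sum.inl i) 1) =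
        Finsupp.single (1, Sum.inl i) 1) ∧
      ∀ k, c (y k) = Finsupp.single (1, Sum.inr k) 1 := by
  let M := H × (I ⊕ K) →₀ ℤ
  let sh : H →* Equiv.Perm M :=
    { toFun := fun h => ⟨shiftF h, shiftF h⁻¹,
        fun m => by rw [← shiftF_mul, inv_mul_cancel, shiftF_one],
        fun m => by rw [← shiftF_mul, mul_inv_cancel, shiftF_one]⟩
      map_one' := Equiv.ext shiftF_one
      map_mul' := fun g h => Equiv.ext (shiftF_mul g h) }
  have sh_apply : ∀ h m, sh h m = shiftF h m := fun _ _ => rfl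
  let ε : I ⊕ K → M := fun s => Finsupp.single (1, s) 1
  obtain ⟨θ, h1, h2⟩ := hs.extend (Equiv.Perm M)
    (fun i => (MulAut.conj (Equiv.addRight (ε (.inl i)))).toMonoidHom.comp
      (sh.comp (A i).subtype))
    (fun k => Equiv.addLeft (ε (.inr k)) * sh (y k))
  have h1' : ∀ i, ∀ a ∈ A i, ∀ m, θ a m = shiftF a (m - ε (.inl i)) + ε (.inl i) := by
    intro i a ha m
    have := h1 i ⟨a, ha⟩
    simp only at this
    rw [this]
    simp only [MonoidHom.comp_apply, MulEquiv.coe_toMonoidHom, MulAut.conj_apply,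
      Equiv.Perm.mul_apply, Subgroup.subtype_apply, sh_apply]
    rw [Equiv.Perm.inv_def, Equiv.addRight_symm]
    simp [sub_eq_add_neg]
  have h2' : ∀ k m, θ (y k) m = ε (.inr k) + shiftF (y k) m := by
    intro k m; rw [h2]; rfl
  have key : ∀ h m, θ h m = θ h 0 + shiftF h m := by
    intro h
    induction h using hs.induction with
    | one => intro m; simp [shiftF_one]
    | mul g h hg hh =>
      intro m
      rw [map_mul, Equiv.Perm.mul_apply, Equiv.Perm.mul_apply, hg, hh, hg (θ h 0), map_add,
        ← shiftF_mul, add_assoc]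
    | inv g hg =>
      intro m
      apply (θ g).injective
      rw [hg (_ + _), map_add, ← shiftF_mul, mul_inv_cancel, shiftF_one, ← add_assoc, ← hg,
        ← Equiv.Perm.mul_apply, ← Equiv.Perm.mul_apply, ← map_mul, mul_inv_cancel, map_one]
      simp
    | fac i a ha =>
      intro m
      rw [h1' i a ha, h1' i a ha, map_sub, map_sub, map_zero]
      abel
    | free k => intro m; rw [h2', h2', map_zero, add_zero]
  refine ⟨fun h => θ h 0, fun g h => ?_, fun i a ha => ?_, fun k => ?_⟩
  · simp only
    rw [map_mul, Equiv.Perm.mul_apply, key]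
  · simp only
    rw [← key, h1' i a ha, sub_self, map_zero, zero_add]
  · simp [h2', ε]

variable {X : Type} [MulAction H X]

/-- The orbits of the base point and of the vertices `b i`. -/
def vertexSet (H : Type) [Group H] {X : Type} [MulAction H X] {I : Type} (o : X) (b : I → X) :
    Set X :=
  {x | (∃ h : H, x = h • o) ∨ ∃ (h : H) (i : I), x = h • b i}

/-- The vertices attached to the generators of a free splitting. -/
def edgeEnd {I K : Type} (y : K → H) (o : X) (b : I → X) : I ⊕ K → X :=
  Sum.elim b fun k => y k • o

/-- Compatibility of a free splitting with an action. -/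
structure IsGoodAction (A : I → Subgroup H) (o : X) (b : I → X) : Prop where
  stab : ∀ i (h : H), h • b i = b i ↔ h ∈ A i
  free : ∀ h : H, h • o = o → h = 1
  distinct : ∀ (h : H) i j, h • b i = b j → i = j
  notBase : ∀ (h : H) i, h • b i ≠ o
  rest : ∀ x ∉ vertexSet H o b, ∀ h : H, h • x = x → h = 1

theorem IsFreeSplitting.exists_pathCocycle (hs : IsFreeSplitting A y) (o : X) (b : I → X)
    (hb : IsGoodAction A o b) :
    ∃ D : X → (H × (I ⊕ K) →₀ ℤ), IsPathCocycle o (edgeEnd y o b) (vertexSet H o b) D := by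
  classical
  obtain ⟨c, c_mul, c_fac, c_free⟩ := hs.exists_crossedHom
  have c_one : c 1 = 0 := by
    have := c_mul 1 1
    rw [shiftF_one, mul_one] at this
    simpa using this
  have c_inv : ∀ h, c h + shiftF h (c h⁻¹) = 0 := fun h => by
    rw [← c_mul, mul_inv_cancel, c_one]
  let R : X → (H × (I ⊕ K) →₀ ℤ) → Prop := fun x m =>
    (∃ h : H, x = h • o ∧ m = c h) ∨
    ∃ (h : H) (i : I), x = h • b i ∧ m = c h + shiftF h (Finsupp.single (1, Sum.inl i) 1)
  have R_smul : ∀ (g : H) x m, R x m → R (g • x) (c g + shiftF g m) := by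
    rintro g x m (⟨h, rfl, rfl⟩ | ⟨h, i, rfl, rfl⟩)
    · exact Or.inl ⟨g * h, by rw [mul_smul], by rw [c_mul]⟩
    · exact Or.inr ⟨g * h, i, by rw [mul_smul], by rw [c_mul, map_add, shiftF_mul, add_assoc]⟩
  have R_unique : ∀ x m m', R x m → R x m' → m = m' := by
    rintro x m m' (⟨h, rfl, rfl⟩ | ⟨h, i, rfl, rfl⟩) (⟨h', hx, rfl⟩ | ⟨h', i', hx, rfl⟩)
    · have := hb.free (h⁻¹ * h') (by rw [mul_smul, ← hx, inv_smul_smul])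
      rw [inv_mul_eq_one] at this; rw [this]
    · exact absurd (by rw [mul_smul, ← hx, inv_smul_smul]) (hb.notBase (h⁻¹ * h') i')
    · exact absurd (by rw [mul_smul, hx, inv_smul_smul]) (hb.notBase (h'⁻¹ * h) i)
    · have e := hb.distinct (h'⁻¹ * h) i i' (by rw [mul_smul, hx, inv_smul_smul])
      subst e
      have := (hb.stab i (h⁻¹ * h')).1 (by rw [mul_smul, ← hx, inv_smul_smul])
      have h3 := c_fac i _ this
      have h4 : h' = h * (h⁻¹ * h') := by group
      rw [h4, c_mul, shiftF_mul, add_assoc, ← map_add, h3]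
  have R_iff : ∀ x, (∃ m, R x m) ↔ x ∈ vertexSet H o b := by
    intro x
    constructor
    · rintro ⟨m, (⟨h, hx, -⟩ | ⟨h, i, hx, -⟩)⟩
      · exact Or.inl ⟨h, hx⟩
      · exact Or.inr ⟨h, i, hx⟩
    · rintro (⟨h, hx⟩ | ⟨h, i, hx⟩)
      · exact ⟨_, Or.inl ⟨h, hx, rfl⟩⟩
      · exact ⟨_, Or.inr ⟨h, i, hx, rfl⟩⟩
  have hrep : ∀ x : X, ∃ g : H, g • (Quotient.out (Quotient.mk (MulAction.orbitRel H X) x)) = x :=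
    fun x => by
      have := Quotient.exact (Quotient.out_eq (Quotient.mk (MulAction.orbitRel H X) x))
      exact (MulAction.orbitRel_apply.1 ((MulAction.orbitRel H X).symm this))
  choose g hg using hrep
  let D : X → (H × (I ⊕ K) →₀ ℤ) := fun x =>
    if hx : ∃ m, R x m then hx.choose else c (g x)
  have D_of : ∀ x m, R x m → D x = m := by
    intro x m h
    have hx : ∃ m, R x m := ⟨m, h⟩
    simp only [D, dif_pos hx]
    exact R_unique x _ _ hx.choose_spec h
  have D_smul : ∀ (h : H) x, D (h • x) = c h + shiftF h (D x) := by
    intro h x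
    by_cases hx : ∃ m, R x m
    · obtain ⟨m, hm⟩ := hx
      rw [D_of x m hm, D_of _ _ (R_smul h x m hm)]
    · have hx' : ¬ ∃ m, R (h • x) m := by
        rintro ⟨m, hm⟩
        have := R_smul h⁻¹ _ _ hm
        rw [inv_smul_smul] at this
        exact hx ⟨_, this⟩
      have hq : (Quotient.mk (MulAction.orbitRel H X) (h • x)) =
          (Quotient.mk (MulAction.orbitRel H X) x) :=
        Quotient.sound (MulAction.orbitRel_apply.2 ⟨h, rfl⟩)
      have h3 : g (h • x) = h * g x := by
        have h5 := hg (h • x)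
        rw [hq] at h5
        have h6 := hg x
        have := hb.rest x (fun h => hx ((R_iff x).2 h)) (h⁻¹ * g (h • x) * (g x)⁻¹) (by
          rw [mul_smul, mul_smul, inv_smul_eq_iff.2 h6.symm, h5, inv_smul_smul])
        rw [mul_assoc, inv_mul_eq_one, eq_mul_inv_iff_mul_eq] at this
        exact this.symm
      simp only [D, dif_neg hx, dif_neg hx', h3, c_mul]
  have D_o : ∀ h : H, D (h • o) = c h := fun h => D_of _ _ (Or.inl ⟨h, rfl, rfl⟩)
  have D_b : ∀ i, D (b i) = Finsupp.single (1, Sum.inl i) 1 := fun i => by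
    refine D_of _ _ (Or.inr ⟨1, i, by rw [one_smul], ?_⟩)
    rw [c_one, shiftF_one, zero_add]
  have bd_c : ∀ h : H, bd o (edgeEnd y o b) (c h) =
      Finsupp.single (h • o) 1 - Finsupp.single o 1 := by
    intro h
    induction h using hs.induction with
    | one => simp [c_one]
    | mul g h hg hh =>
      rw [c_mul, map_add, bd_shiftF, hg, hh, Finsupp.mapDomain_sub, Finsupp.mapDomain_single,
        Finsupp.mapDomain_single, mul_smul]
      abel
    | inv g hg =>
      have h1 : c g⁻¹ = - shiftF g⁻¹ (c g) := by
        have := c_inv g⁻¹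
        rw [inv_inv] at this
        exact eq_neg_of_add_eq_zero_left this
      rw [h1, map_neg, bd_shiftF, hg, Finsupp.mapDomain_sub, Finsupp.mapDomain_single,
        Finsupp.mapDomain_single, inv_smul_smul]
      abel
    | fac i a ha =>
      have h1 := eq_sub_of_add_eq (c_fac i a ha)
      have h2 := (hb.stab i a).2 ha
      rw [h1, shiftF_single, map_sub, bd_single, bd_single]
      simp only [edgeEnd, Sum.elim_inl, one_smul, mul_one, h2]
      abel
    | free k =>
      rw [c_free, bd_single]
      simp [edgeEnd]
  refine ⟨D, fun h x => ?_, ?_, ?_⟩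
  · rw [D_smul, D_o]
  · rintro (i | k)
    · exact D_b i
    · rw [← c_free, ← D_o]; rfl
  · rintro x (⟨h, rfl⟩ | ⟨h, i, rfl⟩)
    · rw [D_o, bd_c]
    · rw [D_smul, map_add, bd_c, D_b, shiftF_single, bd_single]
      simp [edgeEnd]

end Construct

section PathCocycle
variable {H : Type} [Group H] {S X : Type} [MulAction H X] {o : X} {e : S → X}

theorem mapDomain_apply_eq_sum_filter {α β : Type} (f : α → β) (d : α →₀ ℤ) (x : β)
    [DecidablePred fun p => f p = x] :
    Finsupp.mapDomain f d x = (d.filter fun p => f p = x).sum fun _ c => c := by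
  classical
  rw [Finsupp.sum_filter_index, Finsupp.mapDomain, Finsupp.sum_apply, Finsupp.sum,
    Finsupp.support_filter, Finset.sum_filter]
  simp only [Finsupp.single_apply]

theorem linearCombination_bd {M : Type} [AddCommGroup M] (f : X → M) (d : H × S →₀ ℤ) :
    Finsupp.linearCombination ℤ f (bd o e d) =
      Finsupp.linearCombination ℤ (fun p : H × S => f (p.1 • e p.2) - f (p.1 • o)) d := by
  induction d using Finsupp.induction_linear with
  | zero => simp
  | add f g hf hg => simp only [map_add, hf, hg]
  | single p c => simp [bd_single, smul_sub]

namespace IsPathCocycle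
variable {Y : Set X} {D : X → (H × S →₀ ℤ)}

theorem base_zero (hD : IsPathCocycle o e Y D) : D o = 0 := by
  have := hD.coc 1 o
  rw [shiftF_one, one_smul] at this
  simpa using this

theorem apply_eq (hD : IsPathCocycle o e Y D) (x : X) (h : H) (s : S) :
    D x (h, s) = D (h⁻¹ • x) (1, s) - D (h⁻¹ • o) (1, s) := by
  rw [hD.coc h⁻¹ x, Finsupp.add_apply, shiftF_apply]
  simp

theorem sub_eq_linearCombination (hD : IsPathCocycle o e Y D) {M : Type} [AddCommGroup M]
    (f : X → M) {x : X} (hx : x ∈ Y) :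
    f x - f o =
      Finsupp.linearCombination ℤ (fun p : H × S => f (p.1 • e p.2) - f (p.1 • o)) (D x) := by
  rw [← linearCombination_bd, hD.bdry x hx]
  simp

theorem linearCombination_bd_self (hD : IsPathCocycle o e Y D) (d : H × S →₀ ℤ) :
    Finsupp.linearCombination ℤ D (bd o e d) = d := by
  rw [linearCombination_bd]
  have : (fun p : H × S => D (p.1 • e p.2) - D (p.1 • o)) = fun p => Finsupp.single p 1 := by
    funext p
    rw [hD.coc, hD.base, shiftF_single, add_sub_cancel_left, mul_one]
  rw [this]
  induction d using Finsupp.induction_linear with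
  | zero => simp
  | add f g hf hg => simp only [map_add, hf, hg]
  | single p c => simp

theorem bd_injective (hD : IsPathCocycle o e Y D) {d d' : H × S →₀ ℤ}
    (h : bd o e d = bd o e d') : d = d' := by
  rw [← hD.linearCombination_bd_self d, h, hD.linearCombination_bd_self]

end IsPathCocycle

theorem bd_apply [DecidableEq X] (d : H × S →₀ ℤ) (x : X) :
    bd o e d x = ((d.filter fun p => p.1 • e p.2 = x).sum fun _ c => c) -
      (d.filter fun p => p.1 • o = x).sum fun _ c => c := by
  rw [← mapDomain_apply_eq_sum_filter, ← mapDomain_apply_eq_sum_filter]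
  rfl

theorem filter_invariant {α : Type} (d : α →₀ ℤ) (σ : α → α) (hσ : ∀ p, d (σ p) = d p)
    (P : α → Prop) [DecidablePred P] (hP : ∀ p, d p ≠ 0 → (P (σ p) ↔ P p)) (p : α) :
    d.filter P (σ p) = d.filter P p := by
  by_cases h : d p = 0
  · have h' : d (σ p) = 0 := by rw [hσ, h]
    rw [Finsupp.filter_apply, Finsupp.filter_apply, h, h']
    simp
  · simp only [Finsupp.filter_apply, hσ, hP p h]

/-- Two distinct vertices outside of the free orbit have no nontrivial common stabilizer. -/
theorem IsPathCocycle.eq_of_smul_eq {D : X → (H × S →₀ ℤ)}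
    (hD : IsPathCocycle o e Set.univ D) (g : H) (hg : g ≠ 1) (v v' : X)
    (hv : ∀ h : H, h • o ≠ v) (h1 : g • v = v) (h2 : g • v' = v') : v = v' := by
  classical
  by_contra hne
  set d := D v - D v' with hd
  have bdd : bd o e d = Finsupp.single v 1 - Finsupp.single v' 1 := by
    rw [hd, map_sub, hD.bdry v trivial, hD.bdry v' trivial]; abel
  have hshift : shiftF g d = d := by
    have e1 := hD.coc g v
    have e2 := hD.coc g v'
    rw [h1] at e1
    rw [h2] at e2
    rw [hd, map_sub]
    nth_rw 2 [e1]
    nth_rw 2 [e2]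
    abel
  have hinv : ∀ h s, d (g * h, s) = d (h, s) := by
    intro h s
    nth_rw 1 [← hshift]
    rw [shiftF_apply, inv_mul_cancel_left]
  have hd0 : d ≠ 0 := by
    intro h0
    rw [h0, map_zero] at bdd
    have := congrArg (fun f => f v) bdd
    simp [Ne.symm hne] at this
  obtain ⟨⟨h0, s0⟩, hp⟩ := Finsupp.ne_iff.1 hd0
  have hpow : ∀ (k : ℕ) h s, d (g ^ k * h, s) = d (h, s) := by
    intro k
    induction k with
    | zero => simp
    | succ k ih => intro h s; rw [pow_succ', mul_assoc, hinv, ih]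
  have hfin : IsOfFinOrder g := by
    rw [← finite_powers]
    have : (fun x : H => (x * h0, s0)) '' (Submonoid.powers g : Set H) ⊆ d.support := by
      rintro _ ⟨_, ⟨k, rfl⟩, rfl⟩
      simp only [Finset.mem_coe, Finsupp.mem_support_iff]
      rw [hpow]; exact hp
    refine Set.Finite.of_finite_image ((Finset.finite_toSet _).subset this) ?_
    intro a _ b _ hab
    simpa using hab
  have hn : orderOf g ≠ 1 := by rwa [Ne, orderOf_eq_one_iff]
  have hqp : (orderOf g).minFac.Prime := Nat.minFac_prime hn
  set q := (orderOf g).minFac with hq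
  obtain ⟨m, hm⟩ := Nat.minFac_dvd (orderOf g)
  rw [← hq] at hm
  have hopos : 0 < orderOf g := hfin.orderOf_pos
  have hg' : g ^ m ≠ 1 := by
    intro h
    have h3 := orderOf_dvd_of_pow_eq_one h
    have h4 : 0 < m := Nat.pos_of_ne_zero (by rintro rfl; simp [hm] at hopos)
    have := Nat.le_of_dvd h4 h3
    have h5 := hqp.two_le
    nlinarith
  have hgm : (g ^ m) ^ q = 1 := by rw [← pow_mul, mul_comm, ← hm, pow_orderOf_eq_one]
  have hgv : g ^ m • v = v := by
    have : ∀ k : ℕ, g ^ k • v = v := by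
      intro k
      induction k with
      | zero => simp
      | succ k ih => rw [pow_succ, mul_smul, h1, ih]
    exact this m
  have hsum := prime_dvd_sum_of_orbits hqp (fun p : H × S => (g ^ m * p.1, p.2))
    (d.filter fun p => p.1 • e p.2 = v)
    (filter_invariant d _ (fun p => hpow m p.1 p.2) _ (fun p _ => by
      simp only [mul_smul]
      nth_rw 1 [← hgv]
      exact smul_left_cancel_iff _))
    (fun p _ h => hg' (by
      have := congrArg Prod.fst h
      simpa using this)) 1 (fun p _ => by
      have : ∀ k : ℕ, (fun p : H × S => (g ^ m * p.1, p.2))^[k] p = ((g ^ m) ^ k * p.1, p.2) := by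
        intro k
        induction k with
        | zero => simp
        | succ k ih => rw [Function.iterate_succ_apply', ih, pow_succ' (g ^ m)]; simp [mul_assoc]
      rw [this, pow_one, hgm]; simp)
  have h6 := bd_apply (o := o) (e := e) d v
  have h7 : (d.filter fun p : H × S => p.1 • o = v) = 0 := by
    ext p
    rw [Finsupp.filter_apply, if_neg (hv p.1)]; rfl
  rw [h7, bdd, Finsupp.sum_zero_index] at h6
  simp only [Finsupp.sub_apply, Finsupp.single_eq_same, Finsupp.single_apply, sub_zero,
    if_neg (Ne.symm hne)] at h6
  rw [← h6] at hsum
  exact hqp.one_lt.ne' (by exact_mod_cast Int.eq_one_of_dvd_one (by positivity) hsum)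

end PathCocycle

section FixedSupport
variable {H : Type} [Group H] {S X : Type} [MulAction H X] {o : X} {e : S → X}
variable {Y : Set X} {D : X → (H × S →₀ ℤ)}

/-- A finite chain of moved edges, invariant under `θ`, with boundary supported on fixed
vertices, vanishes. -/
theorem IsPathCocycle.eq_zero_of_moved (hD : IsPathCocycle o e Y D) {q : ℕ} (hq : q.Prime)
    (a : ℕ) (θ : H → H) (θX : X → X) (hθ : ∀ (h : H) x, θX (h • x) = θ h • θX x)
    (ho : θX o = o) (he : ∀ s, θX (e s) = e s) (d : H × S →₀ ℤ)
    (h1 : ∀ p : H × S, d (θ p.1, p.2) = d p)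
    (h2 : ∀ p, d p ≠ 0 → θ p.1 ≠ p.1 ∧ θ^[q ^ a] p.1 = p.1)
    (h3 : ∀ x, bd o e d x ≠ 0 → θX x = x) : d = 0 := by
  classical
  have hq0 : (q : ℤ) ≠ 0 := by exact_mod_cast hq.ne_zero
  have iter : ∀ (k : ℕ) (p : H × S),
      (fun p : H × S => (θ p.1, p.2))^[k] p = (θ^[k] p.1, p.2) := by
    intro k
    induction k with
    | zero => simp
    | succ k ih => intro p; rw [Function.iterate_succ_apply', ih, Function.iterate_succ_apply']
  have main : ∀ (k : ℕ) (d : H × S →₀ ℤ), (∀ p : H × S, d (θ p.1, p.2) = d p) →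
      (∀ p, d p ≠ 0 → θ p.1 ≠ p.1 ∧ θ^[q ^ a] p.1 = p.1) →
      (∀ x, bd o e d x ≠ 0 → θX x = x) → ∀ p, (q : ℤ) ^ k ∣ d p := by
    intro k
    induction k with
    | zero => intro d _ _ _ p; simp
    | succ k ih =>
      intro d h1 h2 h3
      have fib : ∀ (ev : H × S → X) (_ : ∀ p : H × S, ev (θ p.1, p.2) = θX (ev p)) (x : X),
          θX x = x → (q : ℤ) ∣ (d.filter fun p => ev p = x).sum fun _ c => c := by
        intro ev hev x hx
        refine prime_dvd_sum_of_orbits hq (fun p : H × S => (θ p.1, p.2)) _ ?_ ?_ a ?_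
        · intro p
          rw [Finsupp.filter_apply, Finsupp.filter_apply, h1 p]
          by_cases hp : d p = 0
          · simp [hp]
          · have : ev (θ p.1, p.2) = x ↔ ev p = x := by
              constructor
              · intro h
                have hk : ∀ k : ℕ, ev (θ^[k + 1] p.1, p.2) = x := by
                  intro k
                  induction k with
                  | zero => exact h
                  | succ k ih =>
                    rw [Function.iterate_succ_apply']
                    exact (hev (_, p.2)).trans ((congrArg θX ih).trans hx)
                have h4 := hk (q ^ a - 1)
                rw [Nat.sub_add_cancel (Nat.one_le_pow _ _ hq.pos), (h2 p hp).2] at h4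
                exact h4
              · intro h
                rw [hev, h, hx]
            simp only [this]
        · intro p hp
          have hp' : d p ≠ 0 := by
            intro h0; apply hp; rw [Finsupp.filter_apply, h0, ite_self]
          exact fun h => (h2 p hp').1 (congrArg Prod.fst h)
        · intro p hp
          have hp' : d p ≠ 0 := by
            intro h0; apply hp; rw [Finsupp.filter_apply, h0, ite_self]
          rw [iter, (h2 p hp').2]
      have hdvd : ∀ x, (q : ℤ) ∣ bd o e d x := by
        intro x
        by_cases hx : bd o e d x = 0
        · simp [hx]
        · have hx' := h3 x hx
          rw [bd_apply]
          exact dvd_sub (fib _ (fun p => by simp only [hθ, he]) x hx')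
            (fib _ (fun p => by simp only [hθ, ho]) x hx')
      let w : X →₀ ℤ := (bd o e d).mapRange (fun c => c / q) (Int.zero_ediv _)
      have hw : bd o e d = (q : ℤ) • w := by
        ext x
        rw [Finsupp.smul_apply, Finsupp.mapRange_apply, smul_eq_mul, Int.mul_ediv_cancel' (hdvd x)]
      set d' := Finsupp.linearCombination ℤ D w with hd'
      have hdd : d = (q : ℤ) • d' := by
        rw [← hD.linearCombination_bd_self d, hw, map_smul]
      have hdp : ∀ p, d p = q * d' p := by
        intro p; rw [hdd]; simp
      have hne : ∀ p, d' p ≠ 0 → d p ≠ 0 := fun p hp => by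
        rw [hdp]; exact mul_ne_zero hq0 hp
      have := ih d' (fun p => by
          have := h1 p
          rw [hdp, hdp] at this
          exact mul_left_cancel₀ hq0 this)
        (fun p hp => h2 p (hne p hp)) (fun x hx => h3 x (by
          rw [hdd, map_zsmul, Finsupp.smul_apply, smul_eq_mul]
          exact mul_ne_zero hq0 hx))
      intro p
      rw [hdp, pow_succ']
      exact mul_dvd_mul_left _ (this p)
  ext p
  have hp := main (d p).natAbs d h1 h2 h3 p
  refine Int.eq_zero_of_abs_lt_dvd hp ?_
  rw [Int.abs_eq_natAbs]
  exact_mod_cast Nat.lt_pow_self hq.one_lt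

theorem IsPathCocycle.fixed_of_mem_support (hD : IsPathCocycle o e Y D) (ψ : H → H) (ψX : X → X)
    (hψ : ∀ (h : H) x, ψX (h • x) = ψ h • ψX x) (hper : ∀ h, ∃ m > 0, ψ^[m] h = h)
    (ho : ψX o = o) (he : ∀ s, ψX (e s) = e s) {x : X} (hx : x ∈ Y) (hfix : ψX x = x) :
    ∀ p, D x p ≠ 0 → ψ p.1 = p.1 := by
  classical
  have hinj : Function.Injective ψ := by
    intro g h hgh
    obtain ⟨m, hm, h1⟩ := hper g
    obtain ⟨k, hk, h2⟩ := hper h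
    have e1 : ψ^[m * k] g = g := (Function.IsPeriodicPt.mul_const h1 k)
    have e2 : ψ^[m * k] h = h := (Function.IsPeriodicPt.const_mul h2 m)
    have h3 : m * k = (m * k - 1) + 1 := (Nat.sub_add_cancel (Nat.mul_pos hm hk)).symm
    rw [h3, Function.iterate_succ_apply] at e1 e2
    rw [← e1, ← e2, hgh]
  have hinv : ∀ p : H × S, D x (ψ p.1, p.2) = D x p := by
    have : Finsupp.mapDomain (fun p : H × S => (ψ p.1, p.2)) (D x) = D x := by
      apply hD.bd_injective
      have : ∀ d : H × S →₀ ℤ, bd o e (Finsupp.mapDomain (fun p : H × S => (ψ p.1, p.2)) d) =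
          Finsupp.mapDomain ψX (bd o e d) := by
        intro d
        induction d using Finsupp.induction_linear with
        | zero => simp
        | add f g hf hg =>
          rw [Finsupp.mapDomain_add, map_add, hf, hg, map_add, Finsupp.mapDomain_add]
        | single p c =>
          rw [Finsupp.mapDomain_single, bd_single, bd_single, Finsupp.mapDomain_sub,
            Finsupp.mapDomain_single, Finsupp.mapDomain_single, hψ, hψ, he, ho]
      rw [this, hD.bdry x hx, Finsupp.mapDomain_sub, Finsupp.mapDomain_single,
        Finsupp.mapDomain_single, hfix, ho]
    intro p
    nth_rw 1 [← this]
    exact Finsupp.mapDomain_apply (f := fun p : H × S => (ψ p.1, p.2))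
      (fun a b hab => by
        obtain ⟨h1, h2⟩ := Prod.mk.inj hab
        exact Prod.ext (hinj h1) h2) (D x) p
  by_contra hcon
  push Not at hcon
  obtain ⟨p0, hp0, hmove⟩ := hcon
  have hper' : ∀ h, 0 < Function.minimalPeriod ψ h := fun h => by
    obtain ⟨m, hm, h1⟩ := hper h
    exact Function.IsPeriodicPt.minimalPeriod_pos hm h1
  have ht0 : Function.minimalPeriod ψ p0.1 ≠ 1 := fun h =>
    hmove (Function.minimalPeriod_eq_one_iff_isFixedPt.1 h)
  have hq := Nat.minFac_prime ht0
  set q := (Function.minimalPeriod ψ p0.1).minFac with hqdef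
  let N := ∏ p ∈ (D x).support, Function.minimalPeriod ψ p.1
  have hN : N ≠ 0 := Finset.prod_ne_zero_iff.2 fun p _ => (hper' p.1).ne'
  have hNp : ∀ p, D x p ≠ 0 → ψ^[N] p.1 = p.1 := fun p hp =>
    (Function.isPeriodicPt_iff_minimalPeriod_dvd.2
      (Finset.dvd_prod_of_mem (fun p : H × S => Function.minimalPeriod ψ p.1)
        (Finsupp.mem_support_iff.2 hp)))
  obtain ⟨a, r, hr, hNr⟩ := Nat.exists_eq_pow_mul_and_not_dvd hN q hq.ne_one
  have iterX : ∀ (k : ℕ) (h : H) v, ψX^[k] (h • v) = ψ^[k] h • ψX^[k] v := by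
    intro k
    induction k with
    | zero => simp
    | succ k ih =>
      intro h v
      rw [Function.iterate_succ_apply', ih, hψ, Function.iterate_succ_apply',
        Function.iterate_succ_apply']
  have hoX : ∀ k : ℕ, ψX^[k] o = o := fun k => Function.iterate_fixed ho k
  have heX : ∀ (k : ℕ) s, ψX^[k] (e s) = e s := fun k s => Function.iterate_fixed (he s) k
  have hinvr : ∀ (k : ℕ) (p : H × S), D x (ψ^[k] p.1, p.2) = D x p := by
    intro k
    induction k with
    | zero => simp
    | succ k ih => intro p; rw [Function.iterate_succ_apply', hinv (_, p.2), ih]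
  set d1 := (D x).filter fun p => ψ^[r] p.1 ≠ p.1 with hd1
  have hinjr : Function.Injective ψ^[r] := hinj.iterate r
  have hz := hD.eq_zero_of_moved hq a ψ^[r] ψX^[r] (iterX r) (hoX r) (heX r) d1
    (fun p => by
      rw [hd1, Finsupp.filter_apply, Finsupp.filter_apply, hinvr]
      simp only [hinjr.ne_iff])
    (fun p hp => by
      rw [hd1, Finsupp.filter_apply] at hp
      have h1 : ψ^[r] p.1 ≠ p.1 := by
        by_contra h; rw [if_neg (not_not.2 h)] at hp; exact hp rfl
      rw [if_pos h1] at hp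
      refine ⟨h1, ?_⟩
      rw [← Function.iterate_mul, mul_comm, ← hNr]
      exact hNp p hp)
    (fun v hv => by
      by_contra hvf
      apply hv
      have hsplit : d1 = D x - (D x).filter fun p => ψ^[r] p.1 = p.1 := by
        rw [hd1, eq_sub_iff_add_eq, add_comm]
        exact Finsupp.filter_add_filter_not _ _
      have hxv : x ≠ v := by
        rintro rfl; exact hvf (Function.iterate_fixed hfix r)
      have hov : o ≠ v := by
        rintro rfl; exact hvf (hoX r)
      have hz1 : ∀ ev : H × S → X, (∀ p : H × S, ψ^[r] p.1 = p.1 → ψX^[r] (ev p) = ev p) →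
          (((D x).filter fun p => ψ^[r] p.1 = p.1).filter fun p => ev p = v) = 0 := by
        intro ev hev
        ext p
        rw [Finsupp.filter_apply, Finsupp.filter_apply]
        split_ifs with h1 h2
        · exact absurd (h1 ▸ hev p h2) hvf
        · rfl
        · rfl
      rw [hsplit, map_sub, Finsupp.sub_apply, hD.bdry x hx, bd_apply,
        hz1 (fun p => p.1 • e p.2) (fun p hp => by simp only [iterX, heX, hp]),
        hz1 (fun p => p.1 • o) (fun p hp => by simp only [iterX, hoX, hp])]
      simp [hxv, hov])
  have h5 : d1 p0 ≠ 0 := by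
    rw [hd1, Finsupp.filter_apply, if_pos]
    · exact hp0
    · intro h
      exact hr ((Nat.minFac_dvd _).trans (Function.isPeriodicPt_iff_minimalPeriod_dvd.1 h))
  exact h5 (by rw [hz]; rfl)

end FixedSupport

section Transfer
variable {Γ X : Type} [Group Γ] [MulAction Γ X]

/-- The total variation of `β` between `o` and `x` along all translates. -/
noncomputable def transfer (Γ : Type) {X : Type} [Group Γ] [MulAction Γ X] (o : X) (β : X → ℤ)
    (x : X) : ℤ :=
  ∑ᶠ g : Γ, (β (g⁻¹ • x) - β (g⁻¹ • o))

theorem transfer_smul (o : X) (β : X → ℤ)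
    (hfin : ∀ x, {g : Γ | β (g⁻¹ • x) - β (g⁻¹ • o) ≠ 0}.Finite) (p : Γ) (x : X) :
    transfer Γ o β (p • x) = transfer Γ o β (p • o) + transfer Γ o β x := by
  have h1 : transfer Γ o β x = ∑ᶠ g : Γ, (β (g⁻¹ • p • x) - β (g⁻¹ • p • o)) := by
    rw [transfer, ← finsum_comp_equiv (Equiv.mulLeft p⁻¹)]
    refine finsum_congr fun g => ?_
    simp [mul_smul]
  have hf : {g : Γ | β (g⁻¹ • p • x) - β (g⁻¹ • p • o) ≠ 0}.Finite := by
    refine ((hfin (p • x)).union (hfin (p • o))).subset fun g hg => ?_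
    by_contra hcon
    simp only [Set.mem_union, Set.mem_ofPred_eq, not_or, not_not] at hcon
    exact hg (by rw [sub_eq_zero.1 hcon.1, sub_eq_zero.1 hcon.2, sub_self])
  rw [h1, transfer, transfer, ← finsum_add_distrib (hfin _) hf]
  exact finsum_congr fun g => by ring

end Transfer

section Smith
variable {H : Type} [Group H] {S X : Type} [MulAction H X] {o : X} {e : S → X}
variable {Y : Set X} {D : X → (H × S →₀ ℤ)}

/-- Modulo `q`, coset sums of path cocycles at fixed vertices are determined by the
augmentations of their coordinates. -/
theorem IsPathCocycle.exists_coset_sum_eq [Fintype S] (hD : IsPathCocycle o e Y D) {q : ℕ}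
    (hq : q.Prime) (ψ : H →* H) (hinj : Function.Injective ψ) (ψX : X → X)
    (hψ : ∀ (h : H) x, ψX (h • x) = ψ h • ψX x) (ho : ψX o = o)
    (γ : H) (hγ : ψ^[q] γ = γ) (s : S) :
    ∃ ζ : S → ℤ, ∀ b ∈ Y, ψX b = b → (∀ p, D b p ≠ 0 → ψ^[q] p.1 = p.1) →
      ∀ G : H →₀ ℤ, (∀ h, ψ h = h → G h = D b (h * γ, s)) → (∀ h, ψ h ≠ h → G h = 0) →
      (q : ℤ) ∣ (G.sum fun _ c => c) - ∑ t, Finsupp.mapDomain Prod.snd (D b) t * ζ t := by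
  classical
  let α : X → ℤ := fun x => D (γ⁻¹ • x) (1, s)
  have hα : ∀ (h : H) x, α (h⁻¹ • x) - α (h⁻¹ • o) = D x (h * γ, s) := by
    intro h x
    rw [hD.apply_eq x (h * γ) s, mul_inv_rev, mul_smul, mul_smul]
  let β : X → ℤ := fun x => ∏ l ∈ Finset.range q, α (ψX^[l] x)
  have iterX : ∀ (k : ℕ) (h : H) v, ψX^[k] (h • v) = ψ^[k] h • ψX^[k] v := by
    intro k
    induction k with
    | zero => simp
    | succ k ih =>
      intro h v
      rw [Function.iterate_succ_apply', ih, hψ, Function.iterate_succ_apply',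
        Function.iterate_succ_apply']
  have hoX : ∀ k : ℕ, ψX^[k] o = o := fun k => Function.iterate_fixed ho k
  have iter_inv : ∀ (k : ℕ) (h : H), ψ^[k] h⁻¹ = (ψ^[k] h)⁻¹ := fun k h =>
    iterate_map_inv ψ k h
  have iter_mul : ∀ (k : ℕ) (g h : H), ψ^[k] (g * h) = ψ^[k] g * ψ^[k] h := fun k g h =>
    iterate_map_mul ψ k g h
  have hβ : ∀ (h : H) x, β (h⁻¹ • x) - β (h⁻¹ • o) ≠ 0 →
      ∃ l < q, D (ψX^[l] x) (ψ^[l] h * γ, s) ≠ 0 := by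
    intro h x hne
    by_contra hcon
    push Not at hcon
    apply hne
    rw [sub_eq_zero]
    refine Finset.prod_congr rfl fun l hl => ?_
    have := hcon l (Finset.mem_range.1 hl)
    rw [← hα, sub_eq_zero] at this
    rw [iterX, iterX, hoX, iter_inv, this]
  have hfin : ∀ x, {g : H | β (g⁻¹ • x) - β (g⁻¹ • o) ≠ 0}.Finite := by
    intro x
    have : {g : H | β (g⁻¹ • x) - β (g⁻¹ • o) ≠ 0} ⊆ ⋃ l ∈ Finset.range q,
        (fun h => (ψ^[l] h * γ, s)) ⁻¹' ((D (ψX^[l] x)).support : Set (H × S)) := by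
      intro h hh
      obtain ⟨l, hl, h1⟩ := hβ h x hh
      simp only [Set.mem_iUnion]
      exact ⟨l, Finset.mem_range.2 hl, Finsupp.mem_support_iff.2 h1⟩
    refine Set.Finite.subset (Set.Finite.biUnion (Finset.finite_toSet _) fun l _ => ?_) this
    refine Set.Finite.preimage (fun a _ b _ hab => ?_) (Finset.finite_toSet _)
    have := congrArg Prod.fst hab
    exact (hinj.iterate l) (mul_right_cancel this)
  have hZ0 : transfer H o β o = 0 := by simp [transfer]
  refine ⟨fun t => transfer H o β (e t), fun b hbY hb hsupp G hG1 hG2 => ?_⟩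
  have hZ : ∑ t, Finsupp.mapDomain Prod.snd (D b) t * transfer H o β (e t) =
      transfer H o β b := by
    have h1 := hD.sub_eq_linearCombination (transfer H o β) hbY
    rw [hZ0, sub_zero] at h1
    have h2 : (fun p : H × S => transfer H o β (p.1 • e p.2) - transfer H o β (p.1 • o)) =
        (fun t => transfer H o β (e t)) ∘ Prod.snd := by
      funext p
      rw [transfer_smul o β hfin, add_sub_cancel_left]; rfl
    rw [h1, h2, ← Finsupp.linearCombination_mapDomain, Finsupp.linearCombination_apply,
      Finsupp.sum_fintype _ _ (by simp)]
    simp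
  rw [hZ]
  let t : H →₀ ℤ := Finsupp.ofSupportFinite (fun h => β (h⁻¹ • b) - β (h⁻¹ • o)) (hfin b)
  have ht : ∀ h, t h = β (h⁻¹ • b) - β (h⁻¹ • o) := fun _ => rfl
  have hts : transfer H o β b = t.sum fun _ c => c := by
    rw [transfer, finsum_eq_sum_of_support_subset (s := t.support) _ (by
      intro h hh
      exact Finsupp.mem_support_iff.2 hh)]
    rfl
  have hbX : ∀ k : ℕ, ψX^[k] b = b := fun k => Function.iterate_fixed hb k
  have htq : ∀ h, t h ≠ 0 → ψ^[q] h = h := by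
    intro h hh
    obtain ⟨l, -, h1⟩ := hβ h b hh
    rw [hbX] at h1
    have h2 := hsupp _ h1
    rw [iter_mul, hγ] at h2
    have h3 := mul_right_cancel h2
    rw [← Function.iterate_add_apply, add_comm, Function.iterate_add_apply] at h3
    exact hinj.iterate l h3
  have cyc : ∀ x, ψX^[q] x = x → β (ψX x) = β x := by
    intro x hx
    obtain ⟨n, rfl⟩ : ∃ n, q = n + 1 := ⟨q - 1, (Nat.sub_add_cancel hq.pos).symm⟩
    simp only [β]
    rw [Finset.prod_range_succ, Finset.prod_range_succ']
    congr 1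
    rw [← Function.iterate_succ_apply, hx]; rfl
  have hinvt' : ∀ h, ψ^[q] h = h → t (ψ h) = t h := by
    intro h hh
    have h1 : ∀ v, ψX v = v → β ((ψ h)⁻¹ • v) = β (h⁻¹ • v) := by
      intro v hv
      rw [← cyc (h⁻¹ • v), hψ, hv, map_inv]
      rw [iterX, iter_inv, hh, Function.iterate_fixed hv]
    rw [ht, ht, h1 b hb, h1 o ho]
  have hinvt : ∀ h, t (ψ h) = t h := by
    intro h
    by_cases hh : ψ^[q] h = h
    · exact hinvt' h hh
    · have h1 : t h = 0 := by
        by_contra h0; exact hh (htq h h0)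
      have h2 : t (ψ h) = 0 := by
        by_contra h0
        have := htq _ h0
        rw [← Function.iterate_succ_apply, Function.iterate_succ_apply'] at this
        exact hh (hinj this)
      rw [h1, h2]
  have hmoved : (q : ℤ) ∣ (t.filter fun h => ψ h ≠ h).sum fun _ c => c := by
    refine prime_dvd_sum_of_orbits hq ψ _ ?_ ?_ 1 ?_
    · intro h
      rw [Finsupp.filter_apply, Finsupp.filter_apply, hinvt]
      simp only [hinj.ne_iff]
    · intro h hh h0
      rw [Finsupp.filter_apply, if_neg (not_not.2 h0)] at hh
      exact hh rfl
    · intro h hh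
      rw [pow_one]
      apply htq
      intro h0; apply hh; rw [Finsupp.filter_apply, h0, ite_self]
  have hfix : (q : ℤ) ∣ (G - t.filter fun h => ψ h = h).sum fun _ c => c := by
    refine Finset.dvd_sum fun h _ => ?_
    rw [Finsupp.sub_apply, Finsupp.filter_apply]
    split_ifs with hh
    · rw [hG1 h hh, ht]
      have hβ' : ∀ v, ψX v = v → β (h⁻¹ • v) = α (h⁻¹ • v) ^ q := by
        intro v hv
        simp only [β]
        rw [Finset.prod_congr rfl (g := fun _ => α (h⁻¹ • v)), Finset.prod_const,
          Finset.card_range]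
        intro l _
        rw [iterX, Function.iterate_fixed hv, iter_inv, Function.iterate_fixed hh]
      rw [hβ' b hb, hβ' o ho, ← hα, ← ZMod.intCast_zmod_eq_zero_iff_dvd _ _]
      have : Fact q.Prime := ⟨hq⟩
      push_cast
      rw [ZMod.pow_card, ZMod.pow_card, sub_self]
    · rw [hG2 h hh]; simp
  have hsum : (G.sum fun _ c => c) - transfer H o β b =
      ((G - t.filter fun h => ψ h = h).sum fun _ c => c) -
        (t.filter fun h => ψ h ≠ h).sum fun _ c => c := by
    rw [hts]
    nth_rw 1 [← Finsupp.filter_add_filter_not t fun h => ψ h = h]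
    rw [Finsupp.sum_add_index' (by simp) (by simp), Finsupp.sum_sub_index (by simp)]
    ring
  rw [hsum]
  exact dvd_sub hfix hmoved

theorem IsPathCocycle.card_le_of_prime [Fintype S] {B : Type} [Fintype B]
    (hD : IsPathCocycle o e Y D) {q : ℕ}
    (hq : q.Prime) (ψ : H →* H) (hinj : Function.Injective ψ) (ψX : X → X)
    (hψ : ∀ (h : H) x, ψX (h • x) = ψ h • ψX x) (ho : ψX o = o)
    (b : B → X) (hbY : ∀ i, b i ∈ Y) (hb : ∀ i, ψX (b i) = b i)
    (hsupp : ∀ i p, D (b i) p ≠ 0 → ψ^[q] p.1 = p.1)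
    (E : B → X → ℤ) (hE : ∀ j (h : H) x, ψ h = h → E j (h • x) = E j (h • o) + E j x)
    (hEo : ∀ j, E j o = 0) (hEb : ∀ i j, i ≠ j → E j (b i) = 0) (hEb' : ∀ i, E i (b i) = 1) :
    Fintype.card B ≤ Fintype.card S := by
  classical
  have : Fact q.Prime := ⟨hq⟩
  let F : Subgroup H := fixedSubgroup ψ
  have memF : ∀ h, h ∈ F ↔ ψ h = h := fun _ => Iff.rfl
  let Q := Quotient (QuotientGroup.rightRel F)
  let π : H × S → Q × S := fun p => (Quotient.mk _ p.1, p.2)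
  have hπ : ∀ p p', π p = π p' ↔ ψ (p'.1 * p.1⁻¹) = p'.1 * p.1⁻¹ ∧ p.2 = p'.2 := by
    intro p p'
    rw [Prod.ext_iff, ← memF, ← QuotientGroup.rightRel_apply]
    exact and_congr_left' Quotient.eq
  let A : B → H × S → ℤ := fun j p => E j (p.1 • e p.2) - E j (p.1 • o)
  have hA : ∀ j, Function.FactorsThrough (A j) π := by
    intro j p p' hp
    obtain ⟨h1, h2⟩ := (hπ p p').1 hp
    have h3 : p' = ((p'.1 * p.1⁻¹) * p.1, p.2) := by
      ext <;> simp [h2]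
    generalize p'.1 * p.1⁻¹ = k at h1 h3
    rw [h3]
    simp only [A]
    rw [mul_smul, mul_smul, hE j _ _ h1, hE j _ (p.1 • o) h1]
    ring
  let A' : B → Q × S → ℤ := fun j => Function.extend π (A j) 0
  have hA' : ∀ j p, A' j (π p) = A j p := fun j p => (hA j).extend_apply 0 p
  let m : B → (Q × S →₀ ℤ) := fun i => Finsupp.mapDomain π (D (b i))
  have hdual : ∀ i j, E j (b i) = (m i).sum fun y c => c * A' j y := by
    intro i j
    have h1 := hD.sub_eq_linearCombination (E j) (hbY i)
    rw [hEo, sub_zero] at h1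
    have h2 : (fun p : H × S => E j (p.1 • e p.2) - E j (p.1 • o)) = A' j ∘ π := by
      funext p; exact (hA' j p).symm
    rw [h1, h2, ← Finsupp.linearCombination_mapDomain, Finsupp.linearCombination_apply]
    rfl
  have hζ : ∀ y : Q × S, ∃ ζ : S → ℤ, ∀ i,
      (q : ℤ) ∣ m i y - ∑ t, Finsupp.mapDomain Prod.snd (D (b i)) t * ζ t := by
    rintro ⟨y, s⟩
    obtain ⟨γ, rfl⟩ := Quotient.exists_rep y
    by_cases hγ : ψ^[q] γ = γ
    · obtain ⟨ζ, h⟩ := hD.exists_coset_sum_eq hq ψ hinj ψX hψ ho γ hγ s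
      refine ⟨ζ, fun i => ?_⟩
      let f : H → H × S := fun h => (h * γ, s)
      have hf : Function.Injective f := fun a b hab => by simpa [f] using hab
      let L := (D (b i)).filter fun p => π p = π (γ, s)
      have hL : (L.support : Set (H × S)) ⊆ Set.range f := by
        intro p hp
        have hp' : π p = π (γ, s) := by
          by_contra h0
          have := Finsupp.mem_support_iff.1 hp
          exact this (by rw [Finsupp.filter_apply, if_neg h0])
        exact ⟨p.1 * γ⁻¹, by ext <;> simp [f, ((hπ _ _).1 hp').2]⟩
      have hG := Finsupp.mapDomain_comapDomain f hf L hL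
      have hm : m i (π (γ, s)) = L.sum fun _ c => c := mapDomain_apply_eq_sum_filter _ _ _
      have hGs : (L.sum fun _ c => c) =
          (Finsupp.comapDomain f L hf.injOn).sum fun _ c => c := by
        nth_rw 1 [← hG]
        rw [Finsupp.sum_mapDomain_index (by simp) (by simp)]
      have hcond : ∀ h : H, π (f h) = π (γ, s) ↔ ψ h = h := by
        intro h
        rw [hπ]
        simp only [f, mul_inv_rev, and_true, mul_inv_cancel_left, map_inv, inv_inj]
      change (q : ℤ) ∣ m i (π (γ, s)) - _
      rw [hm, hGs]
      refine h (b i) (hbY i) (hb i) (hsupp i) _ (fun h hh => ?_) (fun h hh => ?_)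
      · rw [Finsupp.comapDomain_apply, Finsupp.filter_apply, if_pos ((hcond h).2 hh)]
      · rw [Finsupp.comapDomain_apply, Finsupp.filter_apply, if_neg (fun h0 => hh ((hcond h).1 h0))]
    · refine ⟨0, fun i => ?_⟩
      have hm : m i (π (γ, s)) = 0 := by
        refine (mapDomain_apply_eq_sum_filter _ _ _).trans ?_
        refine Finset.sum_eq_zero fun p hp => ?_
        by_contra h0
        rw [Finsupp.filter_apply] at h0
        split_ifs at h0 with h1
        · obtain ⟨h2, -⟩ := (hπ _ _).1 h1
          have h3 : ψ^[q] (γ * p.1⁻¹) = γ * p.1⁻¹ := Function.iterate_fixed h2 q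
          rw [iterate_map_mul, iterate_map_inv, hsupp i p h0] at h3
          exact hγ (mul_right_cancel h3)
        · exact h0 rfl
      change (q : ℤ) ∣ m i (π (γ, s)) - _
      rw [hm]; simp
  choose ζ hζ using hζ
  let L := Fintype.linearCombination (ZMod q)
    (fun i (t : S) => ((Finsupp.mapDomain Prod.snd (D (b i)) t : ℤ) : ZMod q))
  have hL : Function.Injective L := by
    rw [← LinearMap.ker_eq_bot, LinearMap.ker_eq_bot']
    intro c hc
    have hc' : ∀ t, ∑ i, c i * ((Finsupp.mapDomain Prod.snd (D (b i)) t : ℤ) : ZMod q) = 0 := by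
      intro t
      have := congrFun hc t
      rw [Fintype.linearCombination_apply, Finset.sum_apply] at this
      simpa using this
    have hmy : ∀ y, ∑ i, c i * ((m i y : ℤ) : ZMod q) = 0 := by
      intro y
      have h1 : ∀ i, ((m i y : ℤ) : ZMod q) =
          ∑ t, ((Finsupp.mapDomain Prod.snd (D (b i)) t : ℤ) : ZMod q) * (ζ y t : ZMod q) := by
        intro i
        have := (ZMod.intCast_zmod_eq_zero_iff_dvd _ _).2 (hζ y i)
        push_cast at this
        exact sub_eq_zero.1 this
      simp_rw [h1, Finset.mul_sum]
      rw [Finset.sum_comm]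
      refine Finset.sum_eq_zero fun t _ => ?_
      rw [Finset.sum_congr rfl (fun i _ => (mul_assoc _ _ _).symm), ← Finset.sum_mul, hc',
        zero_mul]
    funext j
    let T := Finset.univ.biUnion fun i => (m i).support
    have hEs : ∀ i, E j (b i) = ∑ y ∈ T, m i y * A' j y := by
      intro i
      rw [hdual]
      exact Finsupp.sum_of_support_subset _
        (Finset.subset_biUnion_of_mem (fun i => (m i).support) (Finset.mem_univ i)) _ (by simp)
    have h1 : c j = ∑ i, c i * ((E j (b i) : ℤ) : ZMod q) := by
      rw [Finset.sum_eq_single j (fun i _ hi => by rw [hEb i j hi]; simp) (by simp), hEb']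
      simp
    rw [h1]
    simp_rw [hEs]
    push_cast
    simp_rw [Finset.mul_sum]
    rw [Finset.sum_comm]
    refine Finset.sum_eq_zero fun y _ => ?_
    rw [Finset.sum_congr rfl (fun i _ => (mul_assoc _ _ _).symm), ← Finset.sum_mul, hmy,
      zero_mul]
  simpa using LinearMap.finrank_le_finrank_of_injective hL

end Smith

/-- The real Hilbert space of square-summable functions on `X`. -/
abbrev Ell (X : Type) : Type := lp (fun _ : X => ℝ) 2

/-- The canonical basis vectors of `Ell X`. -/
noncomputable def dl {X : Type} (x : X) : Ell X :=
  letI := Classical.decEq X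
  lp.single 2 x (1 : ℝ)

section Ell
variable {X Y Z : Type}

theorem dl_apply_self (x : X) : dl x x = 1 := by
  classical
  simp [dl]

theorem dl_apply_ne {x y : X} (h : y ≠ x) : dl x y = 0 := by
  classical
  simp [dl, h]

theorem inner_dl_left (x : X) (f : Ell X) : inner ℝ (dl x) f = f x := by
  classical
  rw [dl, lp.inner_single_left]; simp

theorem inner_dl_right (x : X) (f : Ell X) : inner ℝ f (dl x) = f x := by
  rw [real_inner_comm, inner_dl_left]

theorem hasSum_dl (f : Ell X) : HasSum (fun x => f x • dl x) f := by
  classical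
  convert lp.hasSum_single (p := 2) (by simp) f using 2 with x
  ext y
  simp [dl, Pi.single_apply]

theorem ell_ext {F : Type} [NormedAddCommGroup F] [NormedSpace ℝ F] {A B : Ell X →L[ℝ] F}
    (h : ∀ x, A (dl x) = B (dl x)) : A = B := by
  ext f
  have h1 := (hasSum_dl f).mapL A
  have h2 := (hasSum_dl f).mapL B
  simp only [map_smul, h] at h1 h2
  exact h1.unique h2

theorem parseval (f g : Ell X) : HasSum (fun x => f x * g x) (inner ℝ f g) := by
  have := lp.hasSum_inner (𝕜 := ℝ) (G := fun _ : X => ℝ) f g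
  simpa [mul_comm] using this

/-- Restriction of square-summable functions along an injection. -/
noncomputable def pull (f : X → Y) (hf : f.Injective) : Ell Y →L[ℝ] Ell X :=
  LinearMap.mkContinuous
    { toFun := fun v => ⟨fun x => v (f x), by
        have h := (memℓp_gen_iff (p := 2) (by simp)).1 (lp.memℓp v)
        exact memℓp_gen (h.comp_injective hf)⟩
      map_add' := fun _ _ => rfl
      map_smul' := fun _ _ => rfl } 1 fun v => by
    refine lp.norm_le_of_forall_sum_le (p := 2) (by simp) (by positivity) fun s => ?_
    rw [one_mul]
    refine le_trans ?_ (lp.sum_rpow_le_norm_rpow (p := 2) (by simp) v (s.map ⟨f, hf⟩))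
    rw [Finset.sum_map]; rfl

theorem pull_apply (f : X → Y) (hf : f.Injective) (v : Ell Y) (x : X) :
    pull f hf v x = v (f x) := rfl

/-- Push-forward of square-summable functions along an injection. -/
noncomputable def push (f : X → Y) (hf : f.Injective) : Ell X →L[ℝ] Ell Y :=
  ContinuousLinearMap.adjoint (pull f hf)

theorem inner_push (f : X → Y) (hf : f.Injective) (v : Ell X) (w : Ell Y) :
    inner ℝ (push f hf v) w = inner ℝ v (pull f hf w) :=
  ContinuousLinearMap.adjoint_inner_left _ _ _

theorem push_dl (f : X → Y) (hf : f.Injective) (x : X) : push f hf (dl x) = dl (f x) := by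
  ext y
  rw [← inner_dl_right, inner_push, inner_dl_left, pull_apply]
  by_cases h : f x = y
  · subst h; rw [dl_apply_self]
  · rw [dl_apply_ne h, dl_apply_ne (Ne.symm h)]

theorem pull_dl (f : X → Y) (hf : f.Injective) (x : X) : pull f hf (dl (f x)) = dl x := by
  ext y
  rw [pull_apply]
  by_cases h : y = x
  · subst h; rw [dl_apply_self, dl_apply_self]
  · rw [dl_apply_ne h, dl_apply_ne (fun h' => h (hf h'))]

theorem pull_push (f : X → Y) (hf : f.Injective) (v : Ell X) : pull f hf (push f hf v) = v := by
  have : (pull f hf).comp (push f hf) = ContinuousLinearMap.id ℝ _ :=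
    ell_ext fun x => by
      change pull f hf (push f hf (dl x)) = dl x
      rw [push_dl, pull_dl]
  exact congrArg (· v) this

theorem push_apply (f : X → Y) (hf : f.Injective) (v : Ell X) (x : X) :
    push f hf v (f x) = v x := by
  rw [← pull_apply f hf, pull_push]

theorem norm_push (f : X → Y) (hf : f.Injective) (v : Ell X) : ‖push f hf v‖ = ‖v‖ := by
  have : ‖push f hf v‖ ^ 2 = ‖v‖ ^ 2 := by
    rw [← real_inner_self_eq_norm_sq, inner_push, pull_push, real_inner_self_eq_norm_sq]
  exact (pow_left_inj₀ (norm_nonneg _) (norm_nonneg _) (by norm_num)).1 this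

end Ell

section Trace
variable {Γ : Type} [Group Γ] {B C N : Type}

/-- An operator commuting with left translations. -/
def IsEquivariantOp (A : Ell (Γ × B) →L[ℝ] Ell (Γ × N)) : Prop :=
  ∀ g h i k e, A (dl (g * h, i)) (g * k, e) = A (dl (h, i)) (k, e)

theorem IsEquivariantOp.adjoint {A : Ell (Γ × B) →L[ℝ] Ell (Γ × N)} (hA : IsEquivariantOp A) :
    IsEquivariantOp (ContinuousLinearMap.adjoint A) := by
  intro g h i k e
  rw [← inner_dl_right, ← inner_dl_right, ContinuousLinearMap.adjoint_inner_left,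
    ContinuousLinearMap.adjoint_inner_left, inner_dl_left, inner_dl_left, hA]

theorem comp_coeff (T : Ell (Γ × C) →L[ℝ] Ell (Γ × N)) (A : Ell (Γ × B) →L[ℝ] Ell (Γ × C))
    (x : Γ × B) (z : Γ × N) :
    HasSum (fun y => T (dl y) z * A (dl x) y) ((T.comp A) (dl x) z) := by
  have h := parseval (ContinuousLinearMap.adjoint T (dl z)) (A (dl x))
  rw [ContinuousLinearMap.adjoint_inner_left, inner_dl_left] at h
  refine h.congr_fun ?_
  intro y
  rw [← inner_dl_right y (ContinuousLinearMap.adjoint T (dl z)),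
    ContinuousLinearMap.adjoint_inner_left, inner_dl_left]

theorem IsEquivariantOp.comp {T : Ell (Γ × C) →L[ℝ] Ell (Γ × N)}
    {A : Ell (Γ × B) →L[ℝ] Ell (Γ × C)} (hT : IsEquivariantOp T) (hA : IsEquivariantOp A) :
    IsEquivariantOp (T.comp A) := by
  intro g h i k e
  refine (comp_coeff T A (g * h, i) (g * k, e)).unique ?_
  have := comp_coeff T A (h, i) (k, e)
  let E : Γ × C ≃ Γ × C := (Equiv.mulLeft g).prodCongr (Equiv.refl C)
  rw [← E.hasSum_iff]
  convert this using 2 with y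
  change T (dl (g * y.1, y.2)) (g * k, e) * A (dl (g * h, i)) (g * y.1, y.2) = _
  rw [hT, hA]

theorem IsEquivariantOp.sub {T A : Ell (Γ × B) →L[ℝ] Ell (Γ × N)} (hT : IsEquivariantOp T)
    (hA : IsEquivariantOp A) : IsEquivariantOp (T - A) := by
  intro g h i k e
  change T _ _ - A _ _ = T _ _ - A _ _
  rw [hT, hA]

theorem IsEquivariantOp.smul {A : Ell (Γ × B) →L[ℝ] Ell (Γ × N)}
    (hA : IsEquivariantOp A) (c : ℝ) : IsEquivariantOp (c • A) := by
  intro g h i k e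
  change c • A _ _ = c • A _ _
  rw [hA]

theorem IsEquivariantOp.one : IsEquivariantOp (1 : Ell (Γ × B) →L[ℝ] Ell (Γ × B)) := by
  intro g h i k e
  change dl _ _ = dl _ _
  by_cases hh : (k, e) = (h, i)
  · rw [hh]; cases hh; rw [dl_apply_self, dl_apply_self]
  · rw [dl_apply_ne hh, dl_apply_ne]
    intro h'; apply hh; simpa using h'

theorem IsEquivariantOp.pow {A : Ell (Γ × B) →L[ℝ] Ell (Γ × B)}
    (hA : IsEquivariantOp A) (k : ℕ) : IsEquivariantOp (A ^ k) := by
  induction k with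
  | zero => exact IsEquivariantOp.one
  | succ k ih => rw [pow_succ]; exact ih.comp hA

/-- The von Neumann trace. -/
noncomputable def vnTrace [Fintype B] (A : Ell (Γ × B) →L[ℝ] Ell (Γ × B)) : ℝ :=
  ∑ i, A (dl (1, i)) (1, i)

theorem eq_sum_tsum [Fintype N] {f : Γ × N → ℝ} {s : ℝ} (h : HasSum f s) :
    s = ∑ e, ∑' g : Γ, f (g, e) := by
  have hs : Summable (fun y : N × Γ => f (y.2, y.1)) :=
    (Equiv.prodComm N Γ).summable_iff.2 h.summable
  rw [← h.tsum_eq, ← (Equiv.prodComm N Γ).tsum_eq]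
  exact hs.tsum_prod.trans (tsum_fintype _)

theorem vnTrace_comm [Fintype B] [Fintype N] {T : Ell (Γ × N) →L[ℝ] Ell (Γ × B)}
    {A : Ell (Γ × B) →L[ℝ] Ell (Γ × N)} (hT : IsEquivariantOp T) (hA : IsEquivariantOp A) :
    vnTrace (T.comp A) = vnTrace (A.comp T) := by
  have h1 : ∀ i, (T.comp A) (dl (1, i)) (1, i)
      = ∑ e, ∑' h : Γ, T (dl (h, e)) (1, i) * A (dl (1, i)) (h, e) := by
    intro i
    exact eq_sum_tsum (comp_coeff T A (1, i) (1, i))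
  have h2 : ∀ e, (A.comp T) (dl (1, e)) (1, e)
      = ∑ i, ∑' h : Γ, T (dl (h, e)) (1, i) * A (dl (1, i)) (h, e) := by
    intro e
    refine (eq_sum_tsum (comp_coeff A T (1, e) (1, e))).trans (Finset.sum_congr rfl fun i _ => ?_)
    rw [← (Equiv.inv Γ).tsum_eq]
    refine tsum_congr fun g => ?_
    have e1 := hA g g⁻¹ i 1 e
    have e2 := hT g 1 e g⁻¹ i
    simp only [mul_inv_cancel, mul_one] at e1 e2
    change A (dl (g⁻¹, i)) (1, e) * T (dl (1, e)) (g⁻¹, i) = _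
    rw [← e1, ← e2, mul_comm]
  unfold vnTrace
  exact (Finset.sum_congr rfl fun i _ => h1 i).trans
    (Finset.sum_comm.trans (Finset.sum_congr rfl fun e _ => (h2 e).symm))

theorem norm_le_one_aux {E F : Type} [NormedAddCommGroup E] [InnerProductSpace ℝ E]
    [CompleteSpace E] [NormedAddCommGroup F] [InnerProductSpace ℝ F] [CompleteSpace F]
    (A : E →L[ℝ] F) (hA : ‖A‖ ≤ 1) : ‖1 - (ContinuousLinearMap.adjoint A).comp A‖ ≤ 1 := by
  refine ContinuousLinearMap.opNorm_le_bound _ zero_le_one fun x => ?_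
  rw [one_mul]
  refine le_of_sq_le_sq ?_ (norm_nonneg _)
  change ‖x - ContinuousLinearMap.adjoint A (A x)‖ ^ 2 ≤ _
  rw [norm_sub_sq_real, ContinuousLinearMap.adjoint_inner_right, real_inner_self_eq_norm_sq]
  have h1 : ‖ContinuousLinearMap.adjoint A (A x)‖ ≤ ‖A x‖ := by
    refine (ContinuousLinearMap.le_opNorm _ _).trans ?_
    rw [LinearIsometryEquiv.norm_map]
    exact mul_le_of_le_one_left (norm_nonneg _) hA
  nlinarith [norm_nonneg (ContinuousLinearMap.adjoint A (A x)), norm_nonneg (A x)]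

theorem inner_pow_nonneg {E F : Type} [NormedAddCommGroup E] [InnerProductSpace ℝ E]
    [CompleteSpace E] [NormedAddCommGroup F] [InnerProductSpace ℝ F] [CompleteSpace F]
    (A : E →L[ℝ] F) (hA : ‖A‖ ≤ 1) (k : ℕ) (v : F) :
    0 ≤ inner ℝ v (((1 - A.comp (ContinuousLinearMap.adjoint A)) ^ k) v) := by
  set W : F →L[ℝ] F := 1 - A.comp (ContinuousLinearMap.adjoint A) with hW
  have hs : ∀ x y, inner ℝ x (W y) = inner ℝ (W x) y := by
    intro x y
    change inner ℝ x (y - A (ContinuousLinearMap.adjoint A y))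
      = inner ℝ (x - A (ContinuousLinearMap.adjoint A x)) y
    rw [inner_sub_left, inner_sub_right, ← ContinuousLinearMap.adjoint_inner_right A,
      ← ContinuousLinearMap.adjoint_inner_left A]
  have hp : ∀ x, 0 ≤ inner ℝ x (W x) := by
    intro x
    have : inner ℝ x (W x) = ‖x‖ ^ 2 - ‖ContinuousLinearMap.adjoint A x‖ ^ 2 := by
      change inner ℝ x (x - A (ContinuousLinearMap.adjoint A x)) = _
      rw [inner_sub_right, ← ContinuousLinearMap.adjoint_inner_left, real_inner_self_eq_norm_sq,
        real_inner_self_eq_norm_sq]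
    rw [this]
    have h1 : ‖ContinuousLinearMap.adjoint A x‖ ≤ ‖x‖ := by
      refine (ContinuousLinearMap.le_opNorm _ _).trans ?_
      rw [LinearIsometryEquiv.norm_map]
      exact mul_le_of_le_one_left (norm_nonneg _) hA
    nlinarith [norm_nonneg (ContinuousLinearMap.adjoint A x), norm_nonneg x]
  clear_value W
  induction k using Nat.strong_induction_on generalizing v with
  | _ k ih =>
    match k with
    | 0 => simp
    | 1 => simpa using hp v
    | k + 2 =>
      have := ih k (by omega) (W v)
      rw [← hs] at this
      rw [pow_succ', pow_succ]
      exact this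

/-- Comparison of von Neumann dimensions: an injective equivariant operator does not decrease
the rank. -/
theorem card_le_of_injective_equivariant [Fintype B] [Fintype N]
    (A₀ : Ell (Γ × B) →L[ℝ] Ell (Γ × N)) (hA₀ : IsEquivariantOp A₀)
    (hinj₀ : ∀ v, A₀ v = 0 → v = 0) : Fintype.card B ≤ Fintype.card N := by
  obtain ⟨A, hA, hinj, hn⟩ : ∃ A : Ell (Γ × B) →L[ℝ] Ell (Γ × N), IsEquivariantOp A ∧
      (∀ v, A v = 0 → v = 0) ∧ ‖A‖ ≤ 1 := by
    have hpos : (0 : ℝ) < ‖A₀‖ + 1 := by positivity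
    refine ⟨(‖A₀‖ + 1)⁻¹ • A₀, hA₀.smul _, fun v hv => hinj₀ v ?_, ?_⟩
    · change (‖A₀‖ + 1)⁻¹ • A₀ v = 0 at hv
      exact (smul_eq_zero.1 hv).resolve_left (inv_ne_zero hpos.ne')
    · rw [norm_smul, norm_inv, Real.norm_of_nonneg hpos.le, inv_mul_le_iff₀ hpos]
      linarith
  set S := ContinuousLinearMap.adjoint A with hS
  set U : Ell (Γ × B) →L[ℝ] Ell (Γ × B) := 1 - S.comp A with hU
  set W : Ell (Γ × N) →L[ℝ] Ell (Γ × N) := 1 - A.comp S with hW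
  have hSe : IsEquivariantOp S := hA.adjoint
  have hUe : IsEquivariantOp U := IsEquivariantOp.one.sub (hSe.comp hA)
  have hcomm : ∀ k, (U ^ k).comp S = S.comp (W ^ k) := by
    intro k
    induction k with
    | zero => rfl
    | succ k ih =>
      have h1 : U.comp S = S.comp W := by
        ext1 v
        simp [hU, hW]
      rw [pow_succ, pow_succ']
      change (U ^ k).comp (U.comp S) = _
      rw [h1, ← ContinuousLinearMap.comp_assoc, ih]
      have : (W ^ k).comp W = W.comp (W ^ k) := by
        change W ^ k * W = W * W ^ k
        rw [← pow_succ, pow_succ']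
      rw [ContinuousLinearMap.comp_assoc, this]; rfl
  have hstep : ∀ k, vnTrace (U ^ (k + 1)) - vnTrace (U ^ k)
      = vnTrace (W ^ (k + 1)) - vnTrace (W ^ k) := by
    intro k
    have e1 : vnTrace (U ^ (k + 1)) = vnTrace (U ^ k) - vnTrace (((U ^ k).comp S).comp A) := by
      unfold vnTrace
      rw [← Finset.sum_sub_distrib]
      refine Finset.sum_congr rfl fun i _ => ?_
      have : (U ^ (k + 1)) (dl (1, i)) = (U ^ k) (dl (1, i)) - (U ^ k) (S (A (dl (1, i)))) := by
        rw [pow_succ, ← map_sub]; rfl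
      rw [this]; rfl
    have e2 : vnTrace (W ^ (k + 1)) = vnTrace (W ^ k) - vnTrace (A.comp (S.comp (W ^ k))) := by
      unfold vnTrace
      rw [← Finset.sum_sub_distrib]
      refine Finset.sum_congr rfl fun i _ => ?_
      rw [pow_succ']
      rfl
    rw [e1, e2, vnTrace_comm ((hUe.pow k).comp hSe) hA, hcomm]
    ring
  have h0 : ∀ D : Type, ∀ [Fintype D], vnTrace (1 : Ell (Γ × D) →L[ℝ] Ell (Γ × D))
      = Fintype.card D := by
    intro D _
    unfold vnTrace
    simp [dl_apply_self]
  have htr : ∀ k, (Fintype.card B : ℝ) - Fintype.card N ≤ vnTrace (U ^ k) := by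
    intro k
    have e : vnTrace (U ^ k) - Fintype.card B = vnTrace (W ^ k) - Fintype.card N := by
      induction k with
      | zero => rw [pow_zero, pow_zero, h0, h0]; ring
      | succ k ih => linarith [hstep k]
    have : 0 ≤ vnTrace (W ^ k) := by
      refine Finset.sum_nonneg fun i _ => ?_
      rw [← inner_dl_left]
      exact inner_pow_nonneg A hn k _
    linarith
  have hfix : ((U : Ell (Γ × B) →ₗ[ℝ] Ell (Γ × B)).eqLocus
      ((1 : Ell (Γ × B) →L[ℝ] Ell (Γ × B)) : Ell (Γ × B) →ₗ[ℝ] Ell (Γ × B))) = ⊥ := by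
    rw [eq_bot_iff]
    intro v hv
    have hv : U v = v := hv
    have h1 : S (A v) = 0 := by
      have : v - S (A v) = v := hv
      simpa using this
    have h2 : inner ℝ (A v) (A v) = 0 := by
      rw [← ContinuousLinearMap.adjoint_inner_left, ← hS, h1, inner_zero_left]
    exact hinj v (inner_self_eq_zero.1 h2)
  have hlim : ∀ i : B, Filter.Tendsto (fun n => birkhoffAverage ℝ U id n (dl ((1 : Γ), i)) (1, i))
      Filter.atTop (nhds 0) := by
    intro i
    have h2 := (ContinuousLinearMap.tendsto_birkhoffAverage_orthogonalProjection U
      (norm_le_one_aux A hn) (dl ((1 : Γ), i))).inner (𝕜 := ℝ)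
      (tendsto_const_nhds (x := (dl ((1 : Γ), i) : Ell (Γ × B))))
    simp only [inner_dl_right] at h2
    convert h2 using 2
    symm
    have : ∀ v ∈ ((U : Ell (Γ × B) →ₗ[ℝ] Ell (Γ × B)).eqLocus
      ((1 : Ell (Γ × B) →L[ℝ] Ell (Γ × B)) : Ell (Γ × B) →ₗ[ℝ] Ell (Γ × B))), v = 0 := by
      rw [hfix]; simp
    rw [this _ (Subtype.prop _)]; rfl
  have hsum := tendsto_finsetSum Finset.univ fun i _ => hlim i
  rw [Finset.sum_const_zero] at hsum
  have hle : ∀ᶠ n in Filter.atTop, (Fintype.card B : ℝ) - Fintype.card N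
      ≤ ∑ i : B, birkhoffAverage ℝ U id n (dl ((1 : Γ), i)) (1, i) := by
    filter_upwards [Filter.eventually_gt_atTop 0] with n hnpos
    have e : ∑ i : B, birkhoffAverage ℝ U id n (dl ((1 : Γ), i)) (1, i)
        = (n : ℝ)⁻¹ * ∑ k ∈ Finset.range n, vnTrace (U ^ k) := by
      unfold vnTrace
      rw [Finset.sum_comm, Finset.mul_sum]
      refine Finset.sum_congr rfl fun i _ => ?_
      simp only [birkhoffAverage, birkhoffSum, id, ← inner_dl_left, inner_smul_right, inner_sum]
      congr 1
      refine Finset.sum_congr rfl fun k _ => ?_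
      congr 1
      clear * -
      induction k with
      | zero => rfl
      | succ k ih => rw [pow_succ', Function.iterate_succ_apply', ih]; rfl
    rw [e, le_inv_mul_iff₀ (by exact_mod_cast hnpos)]
    calc (n : ℝ) * _ = ∑ k ∈ Finset.range n, ((Fintype.card B : ℝ) - Fintype.card N) := by
          rw [Finset.sum_const, Finset.card_range, nsmul_eq_mul]
      _ ≤ _ := Finset.sum_le_sum fun k _ => htr k
  have := ge_of_tendsto hsum hle
  have : (Fintype.card B : ℝ) ≤ Fintype.card N := by linarith
  exact_mod_cast this

end Trace

section FinToEll
variable {X Y : Type}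

/-- Finitely supported integral functions as square-summable functions. -/
noncomputable def toEll : (X →₀ ℤ) →+ Ell X :=
  Finsupp.liftAddHom fun x => (zmultiplesHom (Ell X)) (dl x)

theorem toEll_single (x : X) (c : ℤ) : toEll (Finsupp.single x c) = c • dl x := by
  simp [toEll]

theorem toEll_apply (d : X →₀ ℤ) (x : X) : toEll d x = d x := by
  classical
  induction d using Finsupp.induction_linear with
  | zero => rw [map_zero]; simp
  | add f g hf hg => rw [map_add, lp.coeFn_add, Pi.add_apply, hf, hg]; simp
  | single y c =>
    rw [toEll_single, ← inner_dl_left, ← Int.cast_smul_eq_zsmul ℝ, inner_smul_right,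
      inner_dl_left]
    by_cases h : x = y
    · subst h; simp [dl_apply_self]
    · rw [dl_apply_ne h, Finsupp.single_eq_of_ne h]; simp

theorem toEll_inner (d : X →₀ ℤ) (v : Ell X) :
    inner ℝ v (toEll d) = d.sum fun x c => (c : ℝ) * v x := by
  classical
  induction d using Finsupp.induction_linear with
  | zero => simp
  | add f g hf hg =>
    rw [map_add, inner_add_right, hf, hg, Finsupp.sum_add_index' (by simp)]
    intro a b c; push_cast; ring
  | single y c =>
    rw [toEll_single, ← Int.cast_smul_eq_zsmul ℝ, inner_smul_right, inner_dl_right,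
      Finsupp.sum_single_index (by simp)]

end FinToEll

section Op
variable {Γ : Type} [Group Γ] {B N : Type}

/-- There is a bounded operator with prescribed finitely supported columns, twisted by an
injective endomorphism. -/
theorem exists_op [Fintype B] (ρ : Γ →* Γ) (hρ : Function.Injective ρ) (d : B → (Γ × N →₀ ℤ)) :
    ∃ A : Ell (Γ × B) →L[ℝ] Ell (Γ × N), ∀ g i, A (dl (g, i)) = toEll (shiftF (ρ g) (d i)) := by
  classical
  have hi : ∀ p : Γ × N, Function.Injective fun x : Γ => (ρ x * p.1, p.2) := by
    intro p x y h
    exact hρ (mul_right_cancel (congrArg Prod.fst h))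
  have hj : ∀ i : B, Function.Injective fun x : Γ => (x, i) := fun i x y h => congrArg Prod.fst h
  refine ⟨∑ i, ∑ p ∈ (d i).support, d i p • (push _ (hi p)).comp (pull _ (hj i)), fun g i => ?_⟩
  have h0 : ∀ k, k ≠ i → pull _ (hj k) (dl (g, i)) = 0 := by
    intro k hk
    ext x
    rw [pull_apply, dl_apply_ne]
    · rfl
    · intro h; exact hk (congrArg (fun z => z.2) h :)
  rw [sum_apply, Finset.sum_eq_single i]
  · have h1 : pull _ (hj i) (dl (g, i)) = dl g := pull_dl _ (hj i) g
    rw [sum_apply]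
    have : ∀ p, (d i p • (push _ (hi p)).comp (pull _ (hj i))) (dl (g, i))
        = toEll (shiftF (ρ g) (Finsupp.single p (d i p))) := by
      intro p
      rw [shiftF_single, toEll_single]
      change d i p • push _ (hi p) (pull _ (hj i) (dl (g, i))) = _
      rw [h1, push_dl]
    rw [Finset.sum_congr rfl fun p _ => this p, ← map_sum, ← map_sum]
    congr 2
    exact (d i).sum_single
  · intro k _ hk
    rw [sum_apply]
    refine Finset.sum_eq_zero fun p _ => ?_
    change d k p • push _ (hi p) (pull _ (hj k) (dl (g, i))) = _
    rw [h0 k hk]; simp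
  · simp

theorem IsEquivariantOp.pull_apply {A : Ell (Γ × B) →L[ℝ] Ell (Γ × N)} (hA : IsEquivariantOp A)
    (g : Γ) (hg : Function.Injective fun x : Γ × B => (g * x.1, x.2)) (v : Ell (Γ × B))
    (k : Γ) (e : N) : A (pull _ hg v) (k, e) = A v (g * k, e) := by
  have h : ∀ (v : Ell (Γ × B)) (z : Γ × N), HasSum (fun x => A (dl x) z * v x) (A v z) := by
    intro v z
    have h := parseval (ContinuousLinearMap.adjoint A (dl z)) v
    rw [ContinuousLinearMap.adjoint_inner_left, inner_dl_left] at h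
    refine h.congr_fun fun y => ?_
    rw [← inner_dl_right y (ContinuousLinearMap.adjoint A (dl z)),
      ContinuousLinearMap.adjoint_inner_left, inner_dl_left]
  refine (h _ _).unique ?_
  have h2 := h v (g * k, e)
  let E : Γ × B ≃ Γ × B := (Equiv.mulLeft g).prodCongr (Equiv.refl B)
  rw [← E.hasSum_iff] at h2
  refine h2.congr_fun fun x => ?_
  change _ = A (dl (g * x.1, x.2)) (g * k, e) * v (g * x.1, x.2)
  rw [hA]; rfl

/-- An eigenvector-type bound: a family of vectors over the group ring which is fixed by a twisted
endomorphism, and independent over the periodic elements, has at most `N` members. -/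
theorem card_le_of_periodic_independent [Fintype B] [Fintype N] (φ : Γ →* Γ)
    (hφ : Function.Injective φ) (d : B → (Γ × N →₀ ℤ))
    (T : (Γ × N →₀ ℤ) →+ (Γ × N →₀ ℤ)) (hT : ∀ g x, T (shiftF g x) = shiftF (φ g) (T x))
    (hd : ∀ i, T (d i) = d i) (θ : B → Γ × N → ℤ)
    (hpair : ∀ i j (g : Γ), (∃ m > 0, φ^[m] g = g) → (g = 1 → i = j →
      (d i).sum (fun p c => c * θ j (g * p.1, p.2)) = 1) ∧ (¬ (g = 1 ∧ i = j) →
      (d i).sum (fun p c => c * θ j (g * p.1, p.2)) = 0))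
    (hfin : ∀ j γ e, {g : Γ | (∃ m > 0, φ^[m] g = g) ∧ θ j (g * γ, e) ≠ 0}.Finite) :
    Fintype.card B ≤ Fintype.card N := by
  classical
  obtain ⟨A, hA⟩ := exists_op (MonoidHom.id Γ) Function.injective_id d
  obtain ⟨T', hT'⟩ := exists_op φ hφ fun e : N => T (Finsupp.single (1, e) 1)
  have hequiv : IsEquivariantOp A := by
    intro g h i k e
    rw [hA, hA, toEll_apply, toEll_apply]
    simp only [MonoidHom.id_apply]
    rw [shiftF_apply, shiftF_apply]
    congr 3; group
  have hT'' : ∀ x, T' (toEll x) = toEll (T x) := by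
    intro x
    induction x using Finsupp.induction_linear with
    | zero => simp
    | add f g hf hg => rw [map_add, map_add, hf, hg, map_add, map_add]
    | single y c =>
      have h1 : Finsupp.single y c = c • shiftF y.1 (Finsupp.single ((1 : Γ), y.2) 1) := by
        rw [shiftF_single]; simp
      rw [h1, map_zsmul, map_zsmul, map_zsmul, map_zsmul, hT, ← hT', shiftF_single, toEll_single]
      simp
  have hΦi : Function.Injective fun x : Γ × B => (φ x.1, x.2) := by
    intro x y h
    exact Prod.ext (hφ (congrArg Prod.fst h)) (congrArg (fun z => z.2) h :)
  set Φ := push _ hΦi with hΦ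
  have hTA : T'.comp A = A.comp Φ := by
    refine ell_ext fun x => ?_
    obtain ⟨g, i⟩ := x
    change T' (A (dl (g, i))) = A (Φ (dl (g, i)))
    rw [hΦ, push_dl, hA, hA, hT'']
    simp only [MonoidHom.id_apply]
    rw [hT, hd]
  refine card_le_of_injective_equivariant A hequiv ?_
  let W : Submodule ℝ (Ell (Γ × B)) := (A : Ell (Γ × B) →ₗ[ℝ] Ell (Γ × N)).ker
  have hWmem : ∀ v, v ∈ W ↔ A v = 0 := fun v => Iff.rfl
  have hWc : IsClosed (W : Set (Ell (Γ × B))) := ContinuousLinearMap.isClosed_ker A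
  have : CompleteSpace W := hWc.completeSpace_coe
  have key : ∀ j, ∀ u ∈ W, u (1, j) = 0 := by
    intro j
    obtain ⟨w, hw, hwu⟩ : ∃ w ∈ W, ∀ u ∈ W, inner ℝ w u = u (1, j) := by
      refine ⟨W.orthogonalProjectionOnto (dl (1, j)), Subtype.prop _, fun u hu => ?_⟩
      have := W.starProjection_inner_eq_zero (dl (1, j)) u hu
      rw [inner_sub_left, inner_dl_left, sub_eq_zero] at this
      exact this.symm
    have hΦw : Φ w = w := by
      have hΦW : Φ w ∈ W := by
        rw [hWmem]
        have := congrArg (· w) hTA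
        change T' (A w) = A (Φ w) at this
        rw [← this, (hWmem w).1 hw, map_zero]
      have e1 : inner ℝ w (Φ w) = inner ℝ w w := by
        rw [hwu _ hΦW, hwu _ hw]
        have := push_apply _ hΦi w (1, j)
        simpa using this
      have : ‖w - Φ w‖ ^ 2 = 0 := by
        rw [norm_sub_sq_real, e1, hΦ, norm_push, real_inner_self_eq_norm_sq]; ring
      have := norm_eq_zero.1 (pow_eq_zero_iff (by norm_num) |>.1 this)
      exact (sub_eq_zero.1 this).symm
    have hstep : ∀ g i, w (φ g, i) = w (g, i) := by
      intro g i
      have := push_apply _ hΦi w (g, i)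
      rw [← hΦ, hΦw] at this
      exact this
    have hiter : ∀ g i (k : ℕ), w (φ^[k] g, i) = w (g, i) := by
      intro g i k
      induction k with
      | zero => rfl
      | succ k ih => rw [Function.iterate_succ_apply', hstep, ih]
    have hnonper : ∀ g i, ¬ (∃ m > 0, φ^[m] g = g) → w (g, i) = 0 := by
      intro g i hg
      have hinj : Function.Injective fun k : ℕ => (φ^[k] g, i) := by
        have aux : ∀ a b : ℕ, a < b → φ^[a] g ≠ φ^[b] g := by
          intro a b hab h
          apply hg
          refine ⟨b - a, by omega, ?_⟩
          apply hφ.iterate a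
          rw [← Function.iterate_add_apply, h]
          congr 2; omega
        intro a b h
        have h : φ^[a] g = φ^[b] g := congrArg Prod.fst h
        rcases lt_trichotomy a b with hab | hab | hab
        · exact absurd h (aux a b hab)
        · exact hab
        · exact absurd h.symm (aux b a hab)
      have hs := ((parseval w w).summable).comp_injective hinj
      have : (fun x : Γ × B => w x * w x) ∘ (fun k : ℕ => (φ^[k] g, i))
          = fun _ => w (g, i) * w (g, i) := by
        funext k
        simp only [Function.comp_apply, hiter]
      rw [this, summable_const_iff] at hs
      exact mul_self_eq_zero.1 hs
    -- the test vector
    let Rs : Finset Γ := Finset.univ.biUnion fun i => (d i).support.image Prod.fst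
    have hF : {y : Γ × N | (∃ g, (∃ m > 0, φ^[m] g = g) ∧ ∃ r ∈ Rs, y.1 = g * r) ∧
        θ j y ≠ 0}.Finite := by
      refine Set.Finite.subset (Set.Finite.biUnion Rs.finite_toSet fun r _ =>
        Set.finite_iUnion fun e : N => (hfin j r e).image fun g => (g * r, e)) ?_
      rintro ⟨h, e⟩ ⟨⟨g, hg, r, hr, rfl⟩, hθ⟩
      simp only [Set.mem_iUnion]
      exact ⟨r, hr, e, g, ⟨hg, hθ⟩, rfl⟩
    let ξ : Γ × N →₀ ℤ := ∑ y ∈ hF.toFinset, Finsupp.single y (θ j y)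
    have hξ : ∀ y, (∃ g, (∃ m > 0, φ^[m] g = g) ∧ ∃ r ∈ Rs, y.1 = g * r) → ξ y = θ j y := by
      intro y hy
      simp only [ξ, Finsupp.finsetSum_apply, Finsupp.single_apply]
      rw [Finset.sum_ite_eq' hF.toFinset y]
      split_ifs with h
      · rfl
      · by_contra h'
        exact h (hF.mem_toFinset.2 ⟨hy, fun h => h' h.symm⟩)
    have hcol : ∀ g i, (∃ m > 0, φ^[m] g = g) →
        ContinuousLinearMap.adjoint A (toEll ξ) (g, i)
          = ((d i).sum (fun p c => c * θ j (g * p.1, p.2)) : ℤ) := by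
      intro g i hg
      rw [← inner_dl_right, ContinuousLinearMap.adjoint_inner_left, hA, toEll_inner]
      simp only [MonoidHom.id_apply, shiftF, Finsupp.mapDomain.addMonoidHom_apply]
      rw [Finsupp.sum_mapDomain_index (by simp) (by intros; push_cast; ring)]
      rw [Finsupp.sum, Finsupp.sum]
      push_cast
      refine Finset.sum_congr rfl fun p hp => ?_
      rw [toEll_apply, hξ]
      refine ⟨g, hg, p.1, ?_, rfl⟩
      exact Finset.mem_biUnion.2 ⟨i, Finset.mem_univ _, Finset.mem_image_of_mem _ hp⟩
    have hw1 : w (1, j) = 0 := by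
      have h0 : inner ℝ (ContinuousLinearMap.adjoint A (toEll ξ)) w = 0 := by
        rw [ContinuousLinearMap.adjoint_inner_left, (hWmem w).1 hw, inner_zero_right]
      have h1 := parseval (ContinuousLinearMap.adjoint A (toEll ξ)) w
      rw [h0] at h1
      have hper1 : ∃ m > 0, φ^[m] (1 : Γ) = 1 := ⟨1, one_pos, map_one φ⟩
      refine HasSum.unique ?_ h1
      have h2 := hasSum_single (f := fun x => ContinuousLinearMap.adjoint A (toEll ξ) x * w x)
        (1, j) ?_
      · rw [hcol 1 j hper1, (hpair j j 1 hper1).1 rfl rfl] at h2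
        simpa using h2
      · rintro ⟨g, i⟩ hne
        by_cases hg : ∃ m > 0, φ^[m] g = g
        · rw [hcol g i hg, (hpair i j g hg).2]
          · simp
          · rintro ⟨rfl, rfl⟩; exact hne rfl
        · rw [hnonper g i hg, mul_zero]
    have hw0 : w = 0 := by
      rw [← hwu w hw] at hw1
      exact inner_self_eq_zero.1 hw1
    intro u hu
    rw [← hwu u hu, hw0, inner_zero_left]
  intro v hv
  ext ⟨g, j⟩
  have hg : Function.Injective fun x : Γ × B => (g * x.1, x.2) := by
    intro x y h
    exact Prod.ext (mul_left_cancel (congrArg Prod.fst h)) (congrArg (fun z => z.2) h :)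
  have h1 := key j (pull _ hg v) (by
    rw [hWmem]
    ext ⟨k, e⟩
    rw [hequiv.pull_apply, hv]; rfl)
  rw [pull_apply] at h1
  simpa using h1

end Op

theorem mem_conjSubgroup {G : Type*} [Group G] (g : G) (S : Subgroup G) (x : G) :
    x ∈ conjSubgroup g S ↔ g⁻¹ * x * g ∈ S := by
  constructor
  · rintro ⟨s, hs, rfl⟩
    have : g⁻¹ * (g * s * g⁻¹) * g = s := by group
    change g⁻¹ * (g * s * g⁻¹) * g ∈ S
    rwa [this]
  · intro h
    refine ⟨_, h, ?_⟩
    change g * (g⁻¹ * x * g) * g⁻¹ = x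
    group

section Graph
variable {G X Ed : Type} [Group G] [MulAction G X]

/-- A connected graph labelled by a group acting on its vertices has a spanning tree, and a
potential function along it. -/
theorem exists_potential (x₀ : X) (s r : Ed → X) (l : Ed → G) (hl : ∀ e, l e • s e = r e)
    (conn : ∀ Q : X → Prop, Q x₀ → (∀ e, Q (s e) ↔ Q (r e)) → ∀ x, Q x) :
    ∃ (u : X → G) (T : Set Ed), u x₀ = 1 ∧ (∀ x, u x • x = x₀) ∧
      (∀ e ∈ T, u (r e) * l e = u (s e)) ∧
      ∀ Q : X → Prop, Q x₀ → (∀ e ∈ T, Q (s e) ↔ Q (r e)) → ∀ x, Q x := by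
  classical
  let R : ℕ → Set X := fun n => n.rec {x₀} fun _ R =>
    R ∪ {x | ∃ e, (r e = x ∧ s e ∈ R) ∨ (s e = x ∧ r e ∈ R)}
  have hR : ∀ x, ∃ n, x ∈ R n := by
    refine conn _ ⟨0, rfl⟩ fun e => ⟨?_, ?_⟩
    · rintro ⟨n, hn⟩; exact ⟨n + 1, Or.inr ⟨e, Or.inl ⟨rfl, hn⟩⟩⟩
    · rintro ⟨n, hn⟩; exact ⟨n + 1, Or.inr ⟨e, Or.inr ⟨rfl, hn⟩⟩⟩
  let dep : X → ℕ := fun x => sInf {n | x ∈ R n}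
  have hdep : ∀ x, x ≠ x₀ → ∃ e, (r e = x ∧ dep (s e) < dep x) ∨ (s e = x ∧ dep (r e) < dep x) := by
    intro x hx
    have h1 : x ∈ R (dep x) := Nat.sInf_mem (s := {n | x ∈ R n}) (hR x)
    match h : dep x with
    | 0 => rw [h] at h1; exact absurd h1 hx
    | n + 1 =>
      rw [h] at h1
      rcases h1 with h1 | ⟨e, ⟨h1, h2⟩ | ⟨h1, h2⟩⟩
      · have : dep x ≤ n := Nat.sInf_le (s := {n | x ∈ R n}) h1
        omega
      · exact ⟨e, Or.inl ⟨h1, Nat.lt_succ_of_le (Nat.sInf_le (s := {n | _ ∈ R n}) h2)⟩⟩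
      · exact ⟨e, Or.inr ⟨h1, Nat.lt_succ_of_le (Nat.sInf_le (s := {n | _ ∈ R n}) h2)⟩⟩
  rcases isEmpty_or_nonempty Ed with hE | hE
  · have hx : ∀ x, x = x₀ := conn _ rfl fun e => isEmptyElim e
    exact ⟨fun _ => 1, ∅, rfl, fun x => (one_smul _ _).trans (hx x), fun e => isEmptyElim e,
      fun Q h _ x => hx x ▸ h⟩
  choose! ε hε using hdep
  let F : ∀ x, (∀ z, dep z < dep x → G) → G := fun x f =>
    if hx : x = x₀ then 1 else
      if h : r (ε x) = x ∧ dep (s (ε x)) < dep x then f (s (ε x)) h.2 * (l (ε x))⁻¹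
      else f (r (ε x)) (((hε x hx).resolve_left h).2) * l (ε x)
  have wf : WellFounded fun a b : X => dep a < dep b := (measure dep).wf
  let u : X → G := wf.fix F
  have hu : ∀ x, u x = F x fun z _ => u z := fun x => wf.fix_eq F x
  have hu0 : u x₀ = 1 := by rw [hu]; simp [F]
  have huT : ∀ x, x ≠ x₀ → u (r (ε x)) * l (ε x) = u (s (ε x)) := by
    intro x hx
    by_cases h : r (ε x) = x ∧ dep (s (ε x)) < dep x
    · have h1 := hu x
      simp only [F, hx, h, and_self, dif_neg, dif_pos, not_false_eq_true] at h1
      rw [h.1, h1]; group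
    · have h1 := hu x
      simp only [F, hx, h, dif_neg, not_false_eq_true] at h1
      rw [((hε x hx).resolve_left h).1, h1]
  have key : ∀ Q : X → Prop, Q x₀ → (∀ x, x ≠ x₀ → (Q (s (ε x)) ↔ Q (r (ε x)))) → ∀ x, Q x := by
    intro Q h0 hQ x
    induction x using wf.induction with
    | _ x ih =>
      by_cases hx : x = x₀
      · rwa [hx]
      · rcases hε x hx with ⟨h1, h2⟩ | ⟨h1, h2⟩
        · rw [← h1]; exact (hQ x hx).1 (ih _ h2)
        · rw [← h1]; exact (hQ x hx).2 (ih _ h2)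
  refine ⟨u, {e | ∃ x, x ≠ x₀ ∧ ε x = e}, hu0, ?_, ?_, ?_⟩
  · refine key _ (by rw [hu0, one_smul]) fun x hx => ?_
    rw [← huT x hx, mul_smul, hl]
  · rintro _ ⟨x, hx, rfl⟩; exact huT x hx
  · intro Q h0 hQ
    exact key Q h0 fun x hx => hQ _ ⟨x, hx, rfl⟩

/-- Cocycles with values in a group can be prescribed on the factors of a free splitting. -/
theorem IsFreeSplitting.exists_cocycle {I K L : Type} [Group L] {A : I → Subgroup G} {y : K → G}
    (hs : IsFreeSplitting A y) (cA : ∀ i, A i → X → L)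
    (hcA : ∀ i (a b : A i) x, cA i (a * b) x = cA i a ((b : G) • x) * cA i b x)
    (cy : K → X → L) :
    ∃ c : G → X → L, (∀ g h x, c (g * h) x = c g (h • x) * c h x) ∧
      (∀ i (a : A i), c a = cA i a) ∧ ∀ k, c (y k) = cy k := by
  have hone : ∀ i x, cA i 1 x = 1 := by
    intro i x
    have := hcA i 1 1 x
    simpa using this
  let ΨA : ∀ i, A i →* Function.End (X × L) := fun i =>
    { toFun := fun a p => ((a : G) • p.1, cA i a p.1 * p.2)
      map_one' := by
        funext p
        simp [hone]; rfl
      map_mul' := by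
        intro a b
        funext p
        change _ = ((a : G) • ((b : G) • p.1), cA i a ((b : G) • p.1) * (cA i b p.1 * p.2))
        rw [hcA, smul_smul, mul_assoc]; rfl }
  let Ψy : K → Equiv.Perm (X × L) := fun k =>
    { toFun := fun p => (y k • p.1, cy k p.1 * p.2)
      invFun := fun p => ((y k)⁻¹ • p.1, (cy k ((y k)⁻¹ • p.1))⁻¹ * p.2)
      left_inv := fun p => by simp
      right_inv := fun p => by simp }
  obtain ⟨Ψ, h1, h2⟩ := hs.extend (Equiv.Perm (X × L)) (fun i => (ΨA i).toHomPerm) Ψy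
  have h1' : ∀ i (a : A i) p, Ψ a p = ((a : G) • p.1, cA i a p.1 * p.2) := by
    intro i a p; rw [h1]; rfl
  have h2' : ∀ k p, Ψ (y k) p = (y k • p.1, cy k p.1 * p.2) := by
    intro k p; rw [h2]; rfl
  have hmul : ∀ g h p, Ψ (g * h) p = Ψ g (Ψ h p) := by
    intro g h p; rw [map_mul]; rfl
  have key : ∀ g x m, Ψ g (x, m) = (g • x, (Ψ g (x, 1)).2 * m) := by
    intro g
    induction g using hs.induction with
    | one => intro x m; simp
    | mul g h hg hh =>
      intro x m
      rw [hmul, hmul, hh, hg, hh x 1, hg _ ((Ψ h (x, 1)).2 * 1), smul_smul]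
      simp [mul_assoc]
    | inv g hg =>
      intro x m
      apply (Ψ g).injective
      have e : ∀ p, Ψ g (Ψ g⁻¹ p) = p := fun p => by
        rw [← hmul, mul_inv_cancel, map_one]; rfl
      have e1 := e (x, 1)
      obtain ⟨x', m', h'⟩ : ∃ x' m', Ψ g⁻¹ (x, 1) = (x', m') := ⟨_, _, rfl⟩
      rw [h', hg] at e1
      rw [e, hg, h']
      have e2 := congrArg Prod.snd e1
      simp only at e2
      simp only [smul_inv_smul]
      have e3 := congrArg Prod.fst e1
      simp only at e3
      rw [← e3, inv_smul_smul, ← mul_assoc, e2, one_mul]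
    | fac i a ha =>
      intro x m
      have := h1' i ⟨a, ha⟩
      simp only at this
      rw [this, this]; simp
    | free k => intro x m; rw [h2', h2']; simp
  refine ⟨fun g x => (Ψ g (x, 1)).2, fun g h x => ?_, fun i a => ?_, fun k => ?_⟩
  · simp only
    rw [hmul, key h x 1, key g]
  · funext x; simp only; rw [h1']; simp
  · funext x; simp only; rw [h2']; simp

end Graph

theorem exists_orbit_reps {G X : Type} [Group G] [MulAction G X] (A : Subgroup G) :
    ∃ (st : X → X) (a : X → A), (∀ x, (a x : G) • st x = x) ∧
      (∀ b ∈ A, ∀ x, st (b • x) = st x) ∧ (∀ x, st x = x → a x = 1) := by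
  classical
  let st : X → X := fun x => (Quotient.mk (MulAction.orbitRel A X) x).out
  have h1 : ∀ x, ∃ a : A, (a : G) • st x = x := by
    intro x
    have : (MulAction.orbitRel A X).r x (st x) :=
      (MulAction.orbitRel A X).symm (Quotient.mk_out (s := MulAction.orbitRel A X) x)
    obtain ⟨a, ha⟩ := this
    exact ⟨a, ha⟩
  choose a ha using h1
  refine ⟨st, fun x => if st x = x then 1 else a x, fun x => ?_, fun b hb x => ?_, fun x hx => ?_⟩
  · simp only
    split_ifs with h
    · simpa using h
    · exact ha x
  · have : Quotient.mk (MulAction.orbitRel A X) (b • x) = Quotient.mk (MulAction.orbitRel A X) x :=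
      Quotient.sound ⟨⟨b, hb⟩, rfl⟩
    simp only [st, this]
  · simp [hx]

/-- Trivial factors can be dropped. -/
theorem IsFreeSplitting.drop_trivial {H I K : Type} [Group H] {A : I → Subgroup H} {y : K → H}
    (hs : IsFreeSplitting A y) (p : I → Prop) (hp : ∀ i, ¬ p i → A i = ⊥) :
    IsFreeSplitting (fun i : {i // p i} => A i) y where
  gen S h1 h2 := by
    refine hs.gen S (fun i => ?_) h2
    by_cases h : p i
    · exact h1 ⟨i, h⟩
    · rw [hp i h]; exact bot_le
  extend L _ f z := by
    classical
    obtain ⟨Φ, h1, h2⟩ := hs.extend L (fun i => if h : p i then f ⟨i, h⟩ else 1) z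
    refine ⟨Φ, fun i a => ?_, h2⟩
    rw [h1, dif_pos i.2]

/-- **Kurosh subgroup theorem.** -/
theorem IsFreeSplitting.kurosh {G I₀ K₀ : Type} [Group G] {A : I₀ → Subgroup G} {y : K₀ → G}
    (hs : IsFreeSplitting A y) (H : Subgroup G) :
    ∃ (I K : Type) (g : I → G) (J : I → I₀) (z : K → H),
      IsFreeSplitting (fun i => (conjSubgroup (g i) (A (J i))).subgroupOf H) z ∧
      (∀ i, (conjSubgroup (g i) (A (J i))).subgroupOf H ≠ ⊥) ∧
      (∀ i i', J i = J i' → (∃ h ∈ H, (h * g i)⁻¹ * g i' ∈ A (J i')) → i = i') ∧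
      ∀ γ j, (conjSubgroup γ (A j)).subgroupOf H ≠ ⊥ →
        ∃ i, J i = j ∧ ∃ h ∈ H, (h * g i)⁻¹ * γ ∈ A j := by
  classical
  let X := G ⧸ H
  let x₀ : X := ((1 : G) : G ⧸ H)
  have hx₀ : ∀ g : G, g • x₀ = x₀ ↔ g ∈ H := by
    intro g
    change ((g * 1 : G) : G ⧸ H) = ((1 : G) : G ⧸ H) ↔ _
    rw [QuotientGroup.eq, mul_one, mul_one, H.inv_mem_iff]
  have htrans : ∀ x : X, ∃ g : G, g • x₀ = x := by
    intro x
    obtain ⟨g, rfl⟩ := QuotientGroup.mk_surjective x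
    exact ⟨g, by change ((g * 1 : G) : G ⧸ H) = _; rw [mul_one]⟩
  clear_value x₀
  have horb := fun i => exists_orbit_reps (X := X) (A i)
  choose st a ha hst ha1 using horb
  have hstst : ∀ i x, st i (st i x) = st i x := by
    intro i x
    have := hst i _ (a i x).2 (st i x)
    rw [ha] at this
    exact this.symm
  let Ed := (X × I₀) ⊕ (X × K₀)
  let s : Ed → X := Sum.elim (fun p => st p.2 p.1) fun p => p.1
  let r : Ed → X := Sum.elim (fun p => p.1) fun p => y p.2 • p.1
  let l : Ed → G := Sum.elim (fun p => a p.2 p.1) fun p => y p.2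
  have hl : ∀ e, l e • s e = r e := by
    rintro (⟨x, i⟩ | ⟨x, k⟩)
    · exact ha i x
    · rfl
  obtain ⟨u, T₀, hu0, hu, huT₀, htree₀⟩ := exists_potential x₀ s r l hl (by
    intro Q h0 hQ
    have : ∀ g : G, ∀ x, Q x ↔ Q (g • x) := by
      intro g
      induction g using hs.induction with
      | one => simp
      | mul g h hg hh => intro x; rw [mul_smul, ← hg, ← hh]
      | inv g hg => intro x; rw [hg (g⁻¹ • x), smul_inv_smul]
      | fac i b hb =>
        intro x
        have h1 := hQ (Sum.inl (x, i))
        have h2 := hQ (Sum.inl (b • x, i))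
        change Q (st i x) ↔ Q x at h1
        change Q (st i (b • x)) ↔ Q (b • x) at h2
        rw [← h1, ← h2, hst i b hb]
      | free k => intro x; exact hQ (Sum.inr (x, k))
    intro x
    obtain ⟨g, rfl⟩ := htrans x
    exact (this g x₀).1 h0)
  obtain ⟨T, huT, htree, hloop⟩ : ∃ T : Set Ed, (∀ e ∈ T, u (r e) * l e = u (s e)) ∧
      (∀ Q : X → Prop, Q x₀ → (∀ e ∈ T, Q (s e) ↔ Q (r e)) → ∀ x, Q x) ∧
      ∀ x i, st i x = x → Sum.inl (x, i) ∈ T := by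
    refine ⟨T₀ ∪ {e | ∃ x i, st i x = x ∧ e = Sum.inl (x, i)}, ?_, ?_, ?_⟩
    · rintro _ (he | ⟨x, i, hx, rfl⟩)
      · exact huT₀ _ he
      · change u x * a i x = u (st i x)
        rw [ha1 i x hx, hx]; simp
    · intro Q h0 hQ
      exact htree₀ Q h0 fun e he => hQ e (Or.inl he)
    · intro x i hx; exact Or.inr ⟨x, i, hx, rfl⟩
  clear huT₀ htree₀
  -- the cocycle of the subgroup
  let η : G → X → H := fun g x => ⟨u (g • x) * g * (u x)⁻¹, by
    rw [← hx₀, mul_smul, mul_smul]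
    conv_lhs => rw [← hu x, inv_smul_smul, hu]⟩
  have hη : ∀ g h x, η (g * h) x = η g (h • x) * η h x := by
    intro g h x
    apply Subtype.ext
    simp only [η, Subgroup.coe_mul, mul_smul]; group
  have hη1 : ∀ x, η 1 x = 1 := by
    intro x
    have := hη 1 1 x
    simpa using this
  have hηinv : ∀ g x, η g⁻¹ (g • x) = (η g x)⁻¹ := by
    intro g x
    rw [eq_inv_iff_mul_eq_one, ← hη, inv_mul_cancel, hη1]
  have hηH : ∀ h : H, η h x₀ = h := by
    intro h
    apply Subtype.ext
    simp only [η, (hx₀ h).2 h.2, hu0]; group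
  have hηT : ∀ e ∈ T, η (l e) (s e) = 1 := by
    intro e he
    apply Subtype.ext
    simp only [η, hl, huT e he]; simp
  let z : {e // e ∉ T} → H := fun e => η (l e) (s e)
  let I := {p : X × I₀ // st p.2 p.1 = p.1}
  let B : I → Subgroup H := fun p => (conjSubgroup (u p.1.1) (A p.1.2)).subgroupOf H
  have hB : ∀ i x, ∀ b ∈ A i, b • st i x = st i x →
      η b (st i x) ∈ B ⟨(st i x, i), hstst i x⟩ := by
    intro i x b hb hbx
    change (η b (st i x) : G) ∈ conjSubgroup _ _
    rw [mem_conjSubgroup]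
    have : (u (st i x))⁻¹ * (η b (st i x) : G) * u (st i x) = b := by
      simp only [η, hbx]; group
    change (u (st i x))⁻¹ * (η b (st i x) : G) * u (st i x) ∈ A i
    rwa [this]
  let β : ∀ i, A i → X → A i := fun i b x => (a i ((b : G) • x))⁻¹ * b * a i x
  have hβfix : ∀ i (b : A i) x, (β i b x : G) • st i x = st i x := by
    intro i b x
    simp only [β, Subgroup.coe_mul, mul_smul, ha, Subgroup.coe_inv]
    rw [inv_smul_eq_iff, ← hst i b b.2 x, ha]
  have hβ : ∀ i (b : A i) x, η b x = η (a i ((b : G) • x)) (st i x) * η (β i b x) (st i x)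
      * (η (a i x) (st i x))⁻¹ := by
    intro i b x
    rw [eq_mul_inv_iff_mul_eq]
    have e1 : η b x * η (a i x) (st i x) = η (b * a i x) (st i x) := by
      rw [hη, ha]
    have e2 : η (a i ((b : G) • x)) (st i x) * η (β i b x) (st i x)
        = η (a i ((b : G) • x) * β i b x) (st i x) := by
      rw [hη, hβfix]
    rw [e1, e2]
    congr 1
    simp only [β, Subgroup.coe_mul, Subgroup.coe_inv]; group
  have hsplit : IsFreeSplitting B z := by
    refine ⟨fun S hS1 hS2 => ?_, fun L _ f w => ?_⟩
    · have hSe : ∀ e, η (l e) (s e) ∈ S := by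
        intro e
        by_cases he : e ∈ T
        · rw [hηT e he]; exact S.one_mem
        · exact hS2 ⟨e, he⟩
      have : ∀ g : G, ∀ x, η g x ∈ S := by
        intro g
        induction g using hs.induction with
        | one => intro x; rw [hη1]; exact S.one_mem
        | mul g h hg hh => intro x; rw [hη]; exact S.mul_mem (hg _) (hh _)
        | inv g hg =>
          intro x
          have := hηinv g (g⁻¹ • x)
          rw [smul_inv_smul] at this
          rw [this]; exact S.inv_mem (hg _)
        | fac i b hb =>
          intro x
          have := hβ i ⟨b, hb⟩ x
          simp only at this
          rw [this]
          refine S.mul_mem (S.mul_mem ?_ ?_) (S.inv_mem (hSe (Sum.inl (x, i))))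
          · have h2 := hSe (Sum.inl (b • x, i))
            change η (a i (b • x)) (st i (b • x)) ∈ S at h2
            rwa [hst i b hb] at h2
          · exact hS1 _ (hB i x _ (Subtype.prop _) (hβfix i ⟨b, hb⟩ x))
        | free k => intro x; exact hSe (Sum.inr (x, k))
      rw [eq_top_iff]
      rintro h -
      rw [← hηH h]; exact this _ _
    · let F : Ed → L := fun e => if he : e ∈ T then 1 else w ⟨e, he⟩
      have hFT : ∀ e ∈ T, F e = 1 := fun e he => dif_pos he
      let ι : ∀ i x, A i → L := fun i x b =>
        if hbx : (b : G) • st i x = st i x then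
          f ⟨(st i x, i), hstst i x⟩ ⟨η b (st i x), hB i x b b.2 hbx⟩
        else 1
      have hιmul : ∀ i x (b b' : A i), (b : G) • st i x = st i x → (b' : G) • st i x = st i x →
          ι i x (b * b') = ι i x b * ι i x b' := by
        intro i x b b' hb hb'
        have hbb : ((b * b' : A i) : G) • st i x = st i x := by
          rw [Subgroup.coe_mul, mul_smul, hb', hb]
        simp only [ι]
        rw [dif_pos hb, dif_pos hb', dif_pos hbb, ← map_mul]
        congr 1
        apply Subtype.ext
        simp only [Subgroup.coe_mul]
        rw [hη, hb']
      have hιst : ∀ i x x', st i x = st i x' → ι i x = ι i x' := by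
        intro i x x' h
        funext b
        have aux : ∀ (p q : X) (hp : st i p = p) (hq : st i q = q)
            (mp : (b : G) • p = p → η b p ∈ B ⟨(p, i), hp⟩)
            (mq : (b : G) • q = q → η b q ∈ B ⟨(q, i), hq⟩), p = q →
            (if h : (b : G) • p = p then f ⟨(p, i), hp⟩ ⟨η b p, mp h⟩ else 1)
              = if h : (b : G) • q = q then f ⟨(q, i), hq⟩ ⟨η b q, mq h⟩ else 1 := by
          rintro p _ hp hq mp mq rfl; rfl
        exact aux _ _ _ _ _ _ h
      obtain ⟨c, hc, hcA, hcy⟩ := hs.exists_cocycle (X := X)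
        (fun i b x => F (Sum.inl ((b : G) • x, i)) * ι i x (β i b x) * (F (Sum.inl (x, i)))⁻¹)
        (by
          intro i b b' x
          have e1 : β i (b * b') x = β i b ((b' : G) • x) * β i b' x := by
            simp only [β, Subgroup.coe_mul, mul_smul]; group
          have hfix := hβfix i b ((b' : G) • x)
          rw [hst i b' b'.2 x] at hfix
          rw [e1, hιmul i x _ _ hfix (hβfix i b' x),
            hιst i ((b' : G) • x) x (hst i b' b'.2 x), Subgroup.coe_mul, mul_smul]
          group)
        (fun k x => F (Sum.inr (x, k)))
      have hc1 : ∀ x, c 1 x = 1 := by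
        intro x
        have := hc 1 1 x
        simpa using this
      have hcinv : ∀ g x, c g⁻¹ (g • x) = (c g x)⁻¹ := by
        intro g x
        rw [eq_inv_iff_mul_eq_one, ← hc, inv_mul_cancel, hc1]
      have hι1 : ∀ i x, ι i x 1 = 1 := by
        intro i x
        have := hιmul i x 1 1 (one_smul _ _) (one_smul _ _)
        simpa using this
      have hFst : ∀ i x, F (Sum.inl (st i x, i)) = 1 := fun i x =>
        hFT _ (hloop _ i (hstst i x))
      have hcl : ∀ e, c (l e) (s e) = F e := by
        rintro (⟨x, i⟩ | ⟨x, k⟩)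
        · change c (a i x) (st i x) = _
          rw [hcA]
          have e1 : β i (a i x) (st i x) = 1 := by
            simp only [β, ha, ha1 i _ (hstst i x)]; simp
          simp only [e1, hι1, hFst, ha]; simp
        · change c (y k) x = _
          rw [hcy]
      have hcu : ∀ x, c (u x) x = 1 := by
        refine htree _ (by rw [hu0, hc1]) fun e he => ?_
        rw [← huT e he, hc, hcl, hFT e he, mul_one, hl]
      have hcu' : ∀ x, c (u x)⁻¹ x₀ = 1 := by
        intro x
        have := hcinv (u x) x
        rw [hu, hcu, inv_one] at this
        exact this
      have hcη : ∀ g x, c (η g x) x₀ = c g x := by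
        intro g x
        change c (u (g • x) * g * (u x)⁻¹) x₀ = c g x
        have e : (u x)⁻¹ • x₀ = x := by rw [inv_smul_eq_iff, hu]
        rw [hc, hc, hcu', e, hcu]; simp
      refine ⟨⟨⟨fun h => c h x₀, by simp [hc1]⟩, fun h h' => ?_⟩, ?_, ?_⟩
      · simp only [Subgroup.coe_mul]
        rw [hc, (hx₀ _).2 h'.2]
      · rintro ⟨⟨x, i⟩, hxi⟩ ⟨b, hb⟩
        change st i x = x at hxi
        change c b x₀ = _
        have hb' : (u x)⁻¹ * (b : G) * u x ∈ A i := (mem_conjSubgroup _ _ _).1 hb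
        set b' : A i := ⟨_, hb'⟩ with hb'def
        have hfix : (b' : G) • x = x := by
          rw [hb'def]
          simp only [mul_smul, hu, (hx₀ _).2 b.2]
          rw [inv_smul_eq_iff, hu]
        have hbη : b = η b' x := by
          apply Subtype.ext
          simp only [η, hfix]
          rw [hb'def]; group
        have hfix' : (b' : G) • st i x = st i x := by rw [hxi, hfix]
        have e1 : β i b' x = b' := by
          simp only [β, hfix, ha1 i x hxi]; simp
        have e2 : c b x₀ = ι i x b' := by
          conv_lhs => rw [hbη]
          rw [hcη, hcA]
          have : F (Sum.inl (x, i)) = 1 := hFT _ (hloop _ i hxi)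
          simp only [e1, hfix, this]; simp
        rw [e2]
        simp only [ι]
        rw [dif_pos hfix']
        have aux : ∀ (x' : X) (hx' : x' = x) (h1 : st i x' = x') (h2 : η b' x' ∈ B ⟨(x', i), h1⟩),
            f ⟨(x', i), h1⟩ ⟨η b' x', h2⟩ = f ⟨(x, i), hxi⟩ ⟨b, hb⟩ := by
          rintro x' rfl h1 h2
          congr 1
          exact Subtype.ext hbη.symm
        exact aux _ hxi _ _
      · rintro ⟨e, he⟩
        change c (η (l e) (s e)) x₀ = _
        rw [hcη, hcl]
        exact dif_neg he
  refine ⟨{p : I // B p ≠ ⊥}, {e // e ∉ T}, fun p => u p.1.1.1, fun p => p.1.1.2, z,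
    hsplit.drop_trivial (fun p => B p ≠ ⊥) (fun p hp => not_not.1 hp), fun p => p.2, ?_, ?_⟩
  · rintro ⟨⟨⟨x, i⟩, hx⟩, _⟩ ⟨⟨⟨x', i'⟩, hx'⟩, _⟩ hii ⟨h, hh, hmem⟩
    simp only at hii hmem hx hx'
    subst hii
    have e0 : (u x')⁻¹ • x₀ = x' := by rw [inv_smul_eq_iff, hu]
    have : ((h * u x)⁻¹ * u x') • x' = x := by
      rw [mul_smul, hu, inv_smul_eq_iff, mul_smul, hu, (hx₀ h).2 hh]
    have h3 := hst i _ hmem x'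
    rw [this, hx, hx'] at h3
    subst h3; rfl
  · intro γ j hγ
    set x := γ⁻¹ • x₀ with hx
    have hγx : γ • x = x₀ := by rw [hx, smul_inv_smul]
    set h := γ * a j x * (u (st j x))⁻¹ with hh
    have hhH : h ∈ H := by
      rw [← hx₀, hh, mul_smul]
      have : (u (st j x))⁻¹ • x₀ = st j x := by rw [inv_smul_eq_iff, hu]
      rw [this, mul_smul, ha, hγx]
    refine ⟨⟨⟨(st j x, j), hstst j x⟩, ?_⟩, rfl, h, hhH, ?_⟩
    · intro hbot
      apply hγ
      rw [eq_bot_iff]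
      rintro b hb
      have hb1 : γ⁻¹ * (b : G) * γ ∈ A j := (mem_conjSubgroup _ _ _).1 hb
      have h4 : (⟨h, hhH⟩ : H)⁻¹ * b * ⟨h, hhH⟩ ∈ B ⟨(st j x, j), hstst j x⟩ := by
        change ((h⁻¹ * b * h : G)) ∈ conjSubgroup _ _
        rw [mem_conjSubgroup]
        have e : (u (st j x))⁻¹ * (h⁻¹ * b * h) * u (st j x)
            = (a j x : G)⁻¹ * (γ⁻¹ * b * γ) * a j x := by
          rw [hh]; group
        change (u (st j x))⁻¹ * (h⁻¹ * b * h) * u (st j x) ∈ A j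
        rw [e]
        exact (A j).mul_mem ((A j).mul_mem ((A j).inv_mem (a j x).2) hb1) (a j x).2
      rw [hbot, Subgroup.mem_bot] at h4
      rw [Subgroup.mem_bot]
      have : b = (⟨h, hhH⟩ : H) * ((⟨h, hhH⟩ : H)⁻¹ * b * ⟨h, hhH⟩) * (⟨h, hhH⟩ : H)⁻¹ := by group
      rw [this, h4]; group
    · have e : (h * u (st j x))⁻¹ * γ = (a j x : G)⁻¹ := by rw [hh]; group
      simp only [e]
      exact (A j).inv_mem (a j x).2

open Function in
/-- The periodic elements of an endomorphism. -/
def periodicSubgroup {G : Type} [Group G] (φ : G →* G) : Subgroup G where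
  carrier := periodicPts φ
  one_mem' := ⟨1, one_pos, by simp [IsPeriodicPt, IsFixedPt]⟩
  mul_mem' := by
    rintro a b ⟨m, hm, ha⟩ ⟨l, hl, hb⟩
    refine ⟨m * l, Nat.mul_pos hm hl, ?_⟩
    have h1 := ha.mul_const l
    have h2 := hb.const_mul m
    simp only [IsPeriodicPt, IsFixedPt] at *
    rw [iterate_map_mul, h1, h2]
  inv_mem' := by
    rintro a ⟨m, hm, ha⟩
    refine ⟨m, hm, ?_⟩
    simp only [IsPeriodicPt, IsFixedPt] at *
    rw [iterate_map_inv, ha]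

theorem mem_periodicSubgroup {G : Type} [Group G] (φ : G →* G) (g : G) :
    g ∈ periodicSubgroup φ ↔ ∃ m > 0, φ^[m] g = g := Iff.rfl

theorem iterate_smul {G X : Type} [Group G] [MulAction G X] {φ : G → G} {f : X → X}
    (hf : ∀ g x, f (g • x) = φ g • f x) (n : ℕ) (g : G) (x : X) :
    f^[n] (g • x) = φ^[n] g • f^[n] x := by
  induction n with
  | zero => rfl
  | succ n ih => rw [Function.iterate_succ_apply', ih, hf, Function.iterate_succ_apply',
      Function.iterate_succ_apply']

/-- A free splitting of a subgroup `H`, adapted to the point stabilizers of an action. -/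
structure IsKuroshBasis {G X : Type} [Group G] [MulAction G X] (H : Subgroup G) (o : X)
    {I K : Type} (b : I → X) (y : K → H) : Prop where
  split : IsFreeSplitting (fun i => (MulAction.stabilizer G (b i)).subgroupOf H) y
  nontrivial : ∀ i, ∃ h ∈ H, h ≠ 1 ∧ h • b i = b i
  distinct : ∀ (h : H) i j, h • b i = b j → i = j
  complete : ∀ x, (∃ h ∈ H, h ≠ 1 ∧ h • x = x) → ∃ i, ∃ h : H, x = h • b i

section Basis
variable {G X : Type} [Group G] [MulAction G X] {o : X} {I K : Type} {H : Subgroup G}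
variable {b : I → X} {y : K → H}

theorem IsKuroshBasis.notBase (hB : IsKuroshBasis H o b y) (hfree : ∀ g : G, g • o = o → g = 1)
    (h : H) (i : I) : h • b i ≠ o := by
  intro h0
  obtain ⟨k, hk, hk1, hk2⟩ := hB.nontrivial i
  apply hk1
  have : (h : G) * k * (h : G)⁻¹ = 1 := by
    apply hfree
    have h0' : b i = (h : G)⁻¹ • o := by rw [← h0]; simp [Subgroup.smul_def]
    rw [mul_smul, mul_smul, ← h0', hk2]; exact h0
  simpa using this

theorem IsKuroshBasis.isGoodAction (hB : IsKuroshBasis H o b y)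
    (hfree : ∀ g : G, g • o = o → g = 1) :
    IsGoodAction (fun i => (MulAction.stabilizer G (b i)).subgroupOf H) o b where
  stab i h := by simp [Subgroup.mem_subgroupOf, Subgroup.smul_def]
  free h hh := Subtype.ext (hfree h hh)
  distinct := hB.distinct
  notBase := hB.notBase hfree
  rest x hx h hh := by
    by_contra h1
    obtain ⟨i, k, hk⟩ := hB.complete x ⟨h, h.2, fun h => h1 (Subtype.ext h), hh⟩
    exact hx (Or.inr ⟨k, i, hk⟩)

end Basis

section Eventual
variable {G X : Type} [Group G] [MulAction G X]

/-- Two points are equivalent if they are eventually identified by `f`. -/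
def eventualSetoid (f : X → X) : Setoid X where
  r u v := ∃ k, f^[k] u = f^[k] v
  iseqv := by
    refine ⟨fun u => ⟨0, rfl⟩, fun ⟨k, h⟩ => ⟨k, h.symm⟩, ?_⟩
    rintro u v w ⟨k, h⟩ ⟨l, h'⟩
    refine ⟨l + k, ?_⟩
    rw [Function.iterate_add_apply, h, ← Function.iterate_add_apply, add_comm,
      Function.iterate_add_apply, h', ← Function.iterate_add_apply]

/-- The action induced on the quotient by eventual equality. -/
abbrev eventualAction (φ : G → G) (f : X → X) (hf : ∀ g x, f (g • x) = φ g • f x) :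
    MulAction G (Quotient (eventualSetoid f)) where
  smul g := Quotient.map (fun x => g • x) (by
    rintro u v ⟨k, h⟩
    refine ⟨k, ?_⟩
    rw [iterate_smul hf, iterate_smul hf, h])
  one_smul := by rintro ⟨x⟩; exact congrArg (Quotient.mk _) (one_smul G x)
  mul_smul := by rintro g h ⟨x⟩; exact congrArg (Quotient.mk _) (mul_smul g h x)

open Function in
theorem eq_of_eventual_eq {f : X → X} {u v : X} (hu : u ∈ periodicPts f) (hv : v ∈ periodicPts f)
    {k : ℕ} (h : f^[k] u = f^[k] v) : u = v := by
  obtain ⟨m, hm, hu⟩ := hu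
  obtain ⟨l, hl, hv⟩ := hv
  have h1 : f^[k * (m * l)] u = f^[k * (m * l)] v := by
    obtain ⟨r, hr⟩ : ∃ r, k * (m * l) = r + k :=
      ⟨k * (m * l) - k, (Nat.sub_add_cancel (Nat.le_mul_of_pos_right k (Nat.mul_pos hm hl))).symm⟩
    rw [hr, iterate_add_apply, h, iterate_add_apply]
  have h2 : IsPeriodicPt f (k * (m * l)) u := (hu.mul_const l).const_mul k
  have h3 : IsPeriodicPt f (k * (m * l)) v := (hv.const_mul m).const_mul k
  rw [← h2.eq, h1, h3.eq]

open Function in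
theorem smul_mem_periodicPts {φ : G →* G} {f : X → X} (hf : ∀ g x, f (g • x) = φ g • f x)
    {g : G} {x : X} (hg : g ∈ periodicSubgroup φ) (hx : x ∈ periodicPts f) :
    g • x ∈ periodicPts f := by
  obtain ⟨m, hm, hg⟩ := hg
  obtain ⟨l, hl, hx⟩ := hx
  refine ⟨m * l, Nat.mul_pos hm hl, ?_⟩
  have h1 := hg.mul_const l
  have h2 := hx.const_mul m
  simp only [IsPeriodicPt, IsFixedPt] at *
  rw [iterate_smul hf, h1, h2]

/-- The elements eventually killed by `φ`. -/
def eventualKer (φ : G →* G) : Subgroup G where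
  carrier := {g | ∃ k, φ^[k] g = 1}
  one_mem' := ⟨0, rfl⟩
  mul_mem' := by
    rintro a b ⟨k, h⟩ ⟨l, h'⟩
    refine ⟨k + l, ?_⟩
    rw [iterate_map_mul, Function.iterate_add_apply φ k l b, h', add_comm,
      Function.iterate_add_apply, h, iterate_map_one, iterate_map_one, one_mul]
  inv_mem' := by rintro a ⟨k, h⟩; exact ⟨k, by rw [iterate_map_inv, h, inv_one]⟩

instance (φ : G →* G) : (eventualKer φ).Normal where
  conj_mem := by
    rintro a ⟨k, h⟩ g
    refine ⟨k, ?_⟩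
    rw [iterate_map_mul, iterate_map_mul, h, iterate_map_inv]; simp

/-- The endomorphism induced on the quotient by the eventual kernel. -/
def eventualHom (φ : G →* G) : G ⧸ eventualKer φ →* G ⧸ eventualKer φ :=
  QuotientGroup.map _ _ φ (by
    rintro a ⟨k, h⟩
    exact ⟨k, by rw [← Function.iterate_succ_apply, Function.iterate_succ_apply', h, map_one]⟩)

theorem eventualHom_mk (φ : G →* G) (g : G) :
    eventualHom φ (g : G ⧸ eventualKer φ) = (φ g : G) := rfl

theorem eventualHom_iterate (φ : G →* G) (n : ℕ) (g : G) :
    (eventualHom φ)^[n] (g : G ⧸ eventualKer φ) = (φ^[n] g : G) := by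
  induction n with
  | zero => rfl
  | succ n ih => rw [Function.iterate_succ_apply', ih, eventualHom_mk,
      Function.iterate_succ_apply']

theorem eventualHom_injective (φ : G →* G) : Function.Injective (eventualHom φ) := by
  rw [injective_iff_map_eq_one]
  intro a
  obtain ⟨g, rfl⟩ := QuotientGroup.mk_surjective a
  rw [eventualHom_mk, QuotientGroup.eq_one_iff, QuotientGroup.eq_one_iff]
  rintro ⟨k, h⟩
  exact ⟨k + 1, h⟩

theorem exists_periodic_of_eventualHom (φ : G →* G) {γ : G ⧸ eventualKer φ}
    (h : ∃ m > 0, (eventualHom φ)^[m] γ = γ) : ∃ g ∈ periodicSubgroup φ, (g : G ⧸ eventualKer φ) = γ := by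
  obtain ⟨g, rfl⟩ := QuotientGroup.mk_surjective γ
  obtain ⟨m, hm, h⟩ := h
  have h0 := h
  rw [eventualHom_iterate, QuotientGroup.eq] at h
  obtain ⟨l, hl⟩ := h
  rw [iterate_map_mul, iterate_map_inv, inv_mul_eq_one] at hl
  obtain ⟨r, hr⟩ : ∃ r, m * l = r + l :=
      ⟨m * l - l, (Nat.sub_add_cancel (Nat.le_mul_of_pos_left l hm)).symm⟩
  refine ⟨φ^[m * l] g, ⟨m, hm, ?_⟩, ?_⟩
  · change φ^[m] _ = _
    rw [hr, Function.iterate_add_apply, (Function.Commute.iterate_iterate_self φ m r).eq,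
      (Function.Commute.iterate_iterate_self φ m l).eq, hl]
  · rw [← eventualHom_iterate]
    exact Function.IsPeriodicPt.mul_const h0 l

theorem eq_one_of_periodic (φ : G →* G) {g : G} (hg : g ∈ periodicSubgroup φ)
    (h : (g : G ⧸ eventualKer φ) = 1) : g = 1 := by
  rw [QuotientGroup.eq_one_iff] at h
  obtain ⟨k, h⟩ := h
  exact eq_of_eventual_eq (k := k) hg (periodicSubgroup φ).one_mem (by rw [h, iterate_map_one])

end Eventual

section Periodic
variable {G X N : Type} [Group G] [MulAction G X] {o : X} {I K : Type}

theorem exists_cocycle_eventual (hfree : ∀ g : G, g • o = o → g = 1)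
    (huniq : ∀ (g : G) (v v' : X), g ≠ 1 → g • v = v → g • v' = v' → v = v')
    (φ : G →* G) (f : X → X) (hf : ∀ g x, f (g • x) = φ g • f x) (hfo : f o = o)
    {b : I → X} {y : K → periodicSubgroup φ} (hB : IsKuroshBasis (periodicSubgroup φ) o b y) :
    ∃ D : Quotient (eventualSetoid f) → (periodicSubgroup φ × (I ⊕ K) →₀ ℤ),
      (∀ (h : periodicSubgroup φ) (x : X), D ⟦(h : G) • x⟧ = D ⟦(h : G) • o⟧ + shiftF h (D ⟦x⟧)) ∧
      ∀ s, D ⟦edgeEnd y o b s⟧ = Finsupp.single (1, s) 1 := by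
  let := eventualAction φ f hf
  have hper : ∀ (g : G) (x : X), g ∈ periodicSubgroup φ → g ≠ 1 → g • x = x →
      x ∈ Function.periodicPts f := by
    rintro g x ⟨m, hm, hg⟩ h1 hx
    refine ⟨m, hm, huniq g _ _ h1 ?_ hx⟩
    have := iterate_smul hf m g x
    rw [hx, hg.eq] at this
    exact this.symm
  have hbper : ∀ i, b i ∈ Function.periodicPts f := by
    intro i
    obtain ⟨h, hh, h1, h2⟩ := hB.nontrivial i
    exact hper h _ hh h1 h2
  have hoper : o ∈ Function.periodicPts f := ⟨1, one_pos, hfo⟩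
  have hs : ∀ (h : periodicSubgroup φ) (x : X),
      h • (⟦x⟧ : Quotient (eventualSetoid f)) = ⟦(h : G) • x⟧ := fun h x => rfl
  have hlift : ∀ (h : periodicSubgroup φ) (u v : X), u ∈ Function.periodicPts f →
      v ∈ Function.periodicPts f →
      (h • (⟦u⟧ : Quotient (eventualSetoid f)) = ⟦v⟧ ↔ h • u = v) := by
    intro h u v hu hv
    constructor
    · intro e
      rw [hs] at e
      obtain ⟨k, hk⟩ := Quotient.exact e
      exact eq_of_eventual_eq (smul_mem_periodicPts hf h.2 hu) hv hk
    · rintro rfl; rfl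
  have hgood := hB.isGoodAction hfree
  have hgood' : IsGoodAction (H := periodicSubgroup φ)
      (fun i => (MulAction.stabilizer G (b i)).subgroupOf (periodicSubgroup φ))
      (⟦o⟧ : Quotient (eventualSetoid f)) (fun i => ⟦b i⟧) := by
    refine ⟨fun i h => ?_, fun h => ?_, fun h i j => ?_, fun h i => ?_, ?_⟩
    · rw [hlift h _ _ (hbper i) (hbper i)]; exact hgood.stab i h
    · rw [hlift h _ _ hoper hoper]; exact hgood.free h
    · rw [hlift h _ _ (hbper i) (hbper j)]; exact hgood.distinct h i j
    · rw [Ne, hlift h _ _ (hbper i) hoper]; exact hgood.notBase h i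
    · intro q
      induction q using Quotient.inductionOn with | _ x => ?_
      intro hx h hh
      by_contra h1
      apply hx
      rw [hs] at hh
      obtain ⟨k, hk⟩ := Quotient.exact hh
      obtain ⟨m, hm, hm'⟩ := h.2
      have h1' : (h : G) ≠ 1 := fun h' => h1 (Subtype.ext h')
      have hk2 : f^[m * k] ((h : G) • x) = f^[m * k] x := by
        obtain ⟨r, hr⟩ : ∃ r, m * k = r + k :=
          ⟨m * k - k, (Nat.sub_add_cancel (Nat.le_mul_of_pos_left k hm)).symm⟩
        rw [hr, Function.iterate_add_apply, hk, ← Function.iterate_add_apply]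
      have hm2 : φ^[m * k] (h : G) = h := hm'.mul_const k
      rw [iterate_smul hf, hm2] at hk2
      obtain ⟨i, h', he⟩ := hB.complete _ ⟨h, h.2, h1', hk2⟩
      refine Or.inr ⟨h', i, ?_⟩
      change _ = ⟦(h' : G) • b i⟧
      have he' : f^[m * k] x = (h' : G) • b i := he
      rw [← he']
      refine Quotient.sound ⟨m * k, huniq h _ _ h1' hk2 ?_⟩
      have := iterate_smul hf (m * k) (h : G) (f^[m * k] x)
      rw [hk2, hm2] at this
      exact this.symm
  obtain ⟨D, hD⟩ := hB.split.exists_pathCocycle _ _ hgood'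
  refine ⟨D, fun h x => hD.coc h ⟦x⟧, ?_⟩
  rintro (i | k)
  · exact hD.base (Sum.inl i)
  · exact hD.base (Sum.inr k)

open Classical in
theorem card_le_of_periodic_basis [Fintype N] {e : N → X} {D : X → (G × N →₀ ℤ)}
    (hD : IsPathCocycle o e Set.univ D)
    (hfree : ∀ g : G, g • o = o → g = 1)
    (huniq : ∀ (g : G) (v v' : X), g ≠ 1 → g • v = v → g • v' = v' → v = v')
    (φ : G →* G) (f : X → X) (hf : ∀ g x, f (g • x) = φ g • f x) (hfo : f o = o)
    {b : I → X} {y : K → periodicSubgroup φ} (hB : IsKuroshBasis (periodicSubgroup φ) o b y)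
    {B : Type} [Fintype B] (β : B → I ⊕ K) (hβ : Function.Injective β)
    (hfix : ∀ i, f (edgeEnd y o b (β i)) = edgeEnd y o b (β i)) :
    Fintype.card B ≤ Fintype.card N := by
  obtain ⟨DP, hcoc, hbase⟩ := exists_cocycle_eventual hfree huniq φ f hf hfo hB
  let mk : G → G ⧸ eventualKer φ := fun g => (g : G ⧸ eventualKer φ)
  have hmk : ∀ g h, mk (g * h) = mk g * mk h := fun g h => rfl
  let q : (G × N →₀ ℤ) →+ ((G ⧸ eventualKer φ) × N →₀ ℤ) :=
    Finsupp.mapDomain.addMonoidHom fun p => (mk p.1, p.2)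
  have hq : ∀ p c, q (Finsupp.single p c) = Finsupp.single (mk p.1, p.2) c := fun p c =>
    Finsupp.mapDomain_single
  have hqs : ∀ g d, q (shiftF g d) = shiftF (mk g) (q d) := by
    intro g d
    induction d using Finsupp.induction_linear with
    | zero => simp
    | add a b ha hb => simp only [map_add, ha, hb]
    | single p c => rw [shiftF_single, hq, hq, shiftF_single, hmk]
  let T : ((G ⧸ eventualKer φ) × N →₀ ℤ) →+ ((G ⧸ eventualKer φ) × N →₀ ℤ) :=
    (Finsupp.linearCombination ℤ fun p : (G ⧸ eventualKer φ) × N =>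
      shiftF (eventualHom φ p.1) (q (D (f (e p.2))))).toAddMonoidHom
  have hTs : ∀ p c, T (Finsupp.single p c) =
      c • shiftF (eventualHom φ p.1) (q (D (f (e p.2)))) := fun p c =>
    Finsupp.linearCombination_single ..
  have hT : ∀ v, T (q (D v)) = q (D (f v)) := by
    intro v
    have h1 := hD.sub_eq_linearCombination (fun x => q (D (f x))) (Set.mem_univ v)
    simp only [hf, hfo, hD.base_zero, map_zero, sub_zero] at h1
    rw [h1]
    have h2 : ∀ p : G × N, q (D (φ p.1 • f (e p.2))) - q (D (φ p.1 • o)) =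
        shiftF (eventualHom φ (mk p.1)) (q (D (f (e p.2)))) := by
      intro p
      rw [hD.coc, map_add, add_sub_cancel_left, hqs]; rfl
    simp only [h2]
    generalize D v = d
    induction d using Finsupp.induction_linear with
    | zero => simp
    | add a b ha hb => simp only [map_add, ha, hb]
    | single p c => rw [hq, hTs, Finsupp.linearCombination_single]
  let κ : B → X → ℤ := fun j x => DP ⟦x⟧ (1, β j)
  have hκ : ∀ j (h : periodicSubgroup φ) x, κ j ((h : G) • x) - κ j ((h : G) • o) =
      DP ⟦x⟧ (h⁻¹, β j) := by
    intro j h x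
    simp only [κ]
    rw [hcoc, Finsupp.add_apply, add_sub_cancel_left, shiftF_apply, mul_one]
  have hinv : ∀ (g g' : G), mk g = mk g' → ∀ j x, κ j (g • x) = κ j (g' • x) := by
    intro g g' h j x
    simp only [κ]
    congr 2
    obtain ⟨k, hk⟩ := QuotientGroup.eq.1 h
    refine Quotient.sound ⟨k, ?_⟩
    rw [iterate_map_mul, iterate_map_inv, inv_mul_eq_one] at hk
    rw [iterate_smul hf, iterate_smul hf, hk]
  let θ : B → (G ⧸ eventualKer φ) × N → ℤ := fun j p =>
    κ j (p.1.out • e p.2) - κ j (p.1.out • o)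
  have hθ : ∀ j g s, θ j (mk g, s) = κ j (g • e s) - κ j (g • o) := by
    intro j g s
    have : mk (mk g).out = mk g := QuotientGroup.out_eq' _
    simp only [θ]
    rw [hinv _ _ this, hinv _ _ this]
  have hpair : ∀ j (h : periodicSubgroup φ) v,
      ((q (D v)).sum fun p c => c * θ j (mk h * p.1, p.2)) = DP ⟦v⟧ (h⁻¹, β j) := by
    intro j h v
    rw [← hκ]
    have h1 := hD.sub_eq_linearCombination (fun x => κ j ((h : G) • x)) (Set.mem_univ v)
    rw [h1]
    generalize D v = d
    change (Finsupp.mapDomain _ d).sum _ = _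
    rw [Finsupp.sum_mapDomain_index (by simp) (by intros; ring), Finsupp.linearCombination_apply]
    refine Finsupp.sum_congr fun p _ => ?_
    rw [← hmk, hθ, smul_eq_mul, mul_smul, mul_smul]
  refine card_le_of_periodic_independent (eventualHom φ) (eventualHom_injective φ)
    (fun i => q (D (edgeEnd y o b (β i)))) T ?_ ?_ θ ?_ ?_
  · intro g x
    induction x using Finsupp.induction_linear with
    | zero => simp
    | add a b ha hb => simp only [map_add, ha, hb]
    | single p c => rw [shiftF_single, hTs, hTs, map_zsmul, map_mul, shiftF_mul]
  · intro i
    rw [hT, hfix]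
  · intro i j g hg
    obtain ⟨h, hh, rfl⟩ := exists_periodic_of_eventualHom φ hg
    have h1 := hpair j ⟨h, hh⟩ (edgeEnd y o b (β i))
    simp only [hbase, Finsupp.single_apply, Prod.mk.injEq, hβ.eq_iff] at h1
    have h2 : (h : G ⧸ eventualKer φ) = 1 ↔ (1 : periodicSubgroup φ) = ⟨h, hh⟩⁻¹ := by
      rw [eq_comm (a := (1 : periodicSubgroup φ)), inv_eq_one]
      constructor
      · intro h3; exact Subtype.ext (eq_one_of_periodic φ hh h3)
      · intro h3; rw [show h = 1 from congrArg Subtype.val h3]; rfl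
    rw [h2]
    refine ⟨fun ha hb => h1.trans (if_pos ⟨ha, hb⟩), fun hn => h1.trans (if_neg hn)⟩
  · intro j γ s
    obtain ⟨g, rfl⟩ := QuotientGroup.mk_surjective γ
    have hfin : {h : periodicSubgroup φ | DP ⟦g • e s⟧ (h⁻¹, β j) ≠ 0 ∨
        DP ⟦g • o⟧ (h⁻¹, β j) ≠ 0}.Finite := by
      have : ∀ d : periodicSubgroup φ × (I ⊕ K) →₀ ℤ,
          {h : periodicSubgroup φ | d (h⁻¹, β j) ≠ 0}.Finite := by
        intro d
        refine d.hasFiniteSupport.preimage (f := fun h => (h⁻¹, β j)) ?_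
        intro a _ b _ hab
        simpa using hab
      exact (this _).union (this _)
    refine (hfin.image fun h : periodicSubgroup φ => mk h).subset ?_
    rintro _ ⟨h1, h2⟩
    obtain ⟨h, hh, rfl⟩ := exists_periodic_of_eventualHom φ h1
    refine ⟨⟨h, hh⟩, ?_, rfl⟩
    by_contra hc
    simp only [Set.mem_ofPred_eq, not_or, not_not] at hc
    apply h2
    have h3 : θ j ((h : G ⧸ eventualKer φ) * (g : G ⧸ eventualKer φ), s) = _ := hθ j (h * g) s
    rw [h3, mul_smul, mul_smul]
    have h4 := hκ j ⟨h, hh⟩ (g • e s)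
    have h5 := hκ j ⟨h, hh⟩ (g • o)
    simp only at h4 h5
    rw [hc.1] at h4
    rw [hc.2] at h5
    linarith

end Periodic

section Compare
variable {G X : Type} [Group G] [MulAction G X] {o : X}

open Classical in
theorem IsKuroshBasis.card_le_of_fixed
    (hfree : ∀ g : G, g • o = o → g = 1)
    (huniq : ∀ (g : G) (v v' : X), g ≠ 1 → g • v = v → g • v' = v' → v = v')
    {P : Subgroup G} {I K : Type} [Fintype (I ⊕ K)] {b : I → X} {y : K → P}
    (hP : IsKuroshBasis P o b y)
    (ψ : P →* P) (hinj : Function.Injective ψ) (f : X → X)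
    (hf : ∀ (h : P) x, f (h • x) = ψ h • f x) (hfo : f o = o) {q : ℕ} (hq : q.Prime)
    (hsupp : ∀ D, IsPathCocycle o (edgeEnd y o b) (vertexSet P o b) D →
      ∀ x ∈ vertexSet P o b, f x = x → ∀ p, D x p ≠ 0 → ψ^[q] p.1 = p.1)
    {H : Subgroup G} (hHP : H ≤ P) (hH : ∀ h : P, ψ h = h ↔ (h : G) ∈ H)
    {I' K' : Type} {b' : I' → X} {y' : K' → H} (hB : IsKuroshBasis H o b' y')
    {B : Type} [Fintype B] (β : B → I' ⊕ K') (hβ : Function.Injective β) :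
    Fintype.card B ≤ Fintype.card (I ⊕ K) := by
  obtain ⟨D, hD⟩ := hP.split.exists_pathCocycle o b (hP.isGoodAction hfree)
  obtain ⟨D', hD'⟩ := hB.split.exists_pathCocycle o b' (hB.isGoodAction hfree)
  have hfix : ∀ s, f (edgeEnd y' o b' s) = edgeEnd y' o b' s := by
    rintro (i | k)
    · obtain ⟨h, hh, h1, h2⟩ := hB.nontrivial i
      refine huniq h _ _ h1 ?_ h2
      have h3 := hf ⟨h, hHP hh⟩ (b' i)
      rw [(hH ⟨h, hHP hh⟩).2 hh] at h3
      have h4 : (⟨h, hHP hh⟩ : P) • b' i = b' i := h2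
      rw [h4] at h3
      exact h3.symm
    · have h3 := hf ⟨y' k, hHP (y' k).2⟩ o
      rw [(hH ⟨y' k, hHP (y' k).2⟩).2 (y' k).2, hfo] at h3
      exact h3
  have hmem : ∀ s, edgeEnd y' o b' s ∈ vertexSet P o b := by
    rintro (i | k)
    · obtain ⟨h, hh, h1, h2⟩ := hB.nontrivial i
      obtain ⟨j, k, hk⟩ := hP.complete _ ⟨h, hHP hh, h1, h2⟩
      exact Or.inr ⟨k, j, hk⟩
    · exact Or.inl ⟨⟨y' k, hHP (y' k).2⟩, rfl⟩
  let ε : B → (H × (I' ⊕ K') →₀ ℤ) →ₗ[ℤ] ℤ := fun j =>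
    Finsupp.linearCombination ℤ fun p => if p.2 = β j then 1 else 0
  have hε : ∀ j h d, ε j (shiftF h d) = ε j d := by
    intro j h d
    induction d using Finsupp.induction_linear with
    | zero => simp
    | add a b ha hb => simp only [map_add, ha, hb]
    | single p c => rw [shiftF_single]; simp [ε]
  refine hD.card_le_of_prime hq ψ hinj f hf hfo (fun i => edgeEnd y' o b' (β i))
    (fun i => hmem _) (fun i => hfix _)
    (fun i p hp => hsupp D hD _ (hmem _) (hfix _) p hp)
    (fun j x => ε j (D' x)) ?_ ?_ ?_ ?_
  · intro j h x hh
    have := hD'.coc ⟨h, (hH h).1 hh⟩ x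
    change D' (h • x) = D' (h • o) + _ at this
    rw [this, map_add, hε]
  · intro j; rw [hD'.base_zero, map_zero]
  · intro i j hij
    rw [hD'.base]
    simp [ε, hβ.eq_iff, hij]
  · intro i
    rw [hD'.base]
    simp [ε]

theorem finite_of_forall_card_le {α : Type} {n : ℕ}
    (h : ∀ (B : Type) [Fintype B] (β : B → α), Function.Injective β → Fintype.card B ≤ n) :
    Finite α ∧ Nat.card α ≤ n := by
  have hf : Finite α := by
    by_contra hc
    rw [not_finite_iff_infinite] at hc
    have := h (Fin (n + 1)) (fun i => Infinite.natEmbedding α i)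
      ((Infinite.natEmbedding α).injective.comp Fin.val_injective)
    simp at this
  refine ⟨hf, ?_⟩
  have := Fintype.ofFinite α
  rw [Nat.card_eq_fintype_card]
  exact h α id Function.injective_id

/-- Every Kurosh basis of `H` has at most `n` elements. -/
def KuroshBound (H : Subgroup G) (o : X) (n : ℕ) : Prop :=
  ∀ (I K : Type) (b : I → X) (y : K → H), IsKuroshBasis H o b y →
    Finite (I ⊕ K) ∧ Nat.card (I ⊕ K) ≤ n

/-- The elements fixed by the `m`-th iterate. -/
def fixedIterate (φ : G →* G) (m : ℕ) : Subgroup G where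
  carrier := {g | φ^[m] g = g}
  one_mem' := iterate_map_one φ m
  mul_mem' := by
    rintro a b ha hb
    simp only [Set.mem_ofPred_eq] at *
    rw [iterate_map_mul, ha, hb]
  inv_mem' := by
    rintro a ha
    simp only [Set.mem_ofPred_eq] at *
    rw [iterate_map_inv, ha]

theorem mem_fixedIterate {φ : G →* G} {m : ℕ} {g : G} :
    g ∈ fixedIterate φ m ↔ φ^[m] g = g := Iff.rfl

/-- An iterate of `φ`, restricted to an invariant subgroup. -/
def restrictIterate (φ : G →* G) (m : ℕ) (P : Subgroup G) (hP : ∀ g ∈ P, φ g ∈ P) : P →* P where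
  toFun g := ⟨φ^[m] (g : G), by
    induction m with
    | zero => exact g.2
    | succ n ih => rw [Function.iterate_succ_apply']; exact hP _ ih⟩
  map_one' := Subtype.ext (iterate_map_one φ m)
  map_mul' a b := Subtype.ext (iterate_map_mul φ m (a : G) (b : G))

theorem restrictIterate_iterate (φ : G →* G) (m : ℕ) (P : Subgroup G) (hP : ∀ g ∈ P, φ g ∈ P)
    (n : ℕ) (g : P) : (((restrictIterate φ m P hP)^[n] g : P) : G) = φ^[m * n] (g : G) := by
  induction n with
  | zero => rfl
  | succ n ih =>
    rw [Function.iterate_succ_apply', mul_add, mul_one, add_comm, Function.iterate_add_apply, ← ih]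
    rfl

theorem map_mem_fixedIterate (φ : G →* G) (m : ℕ) : ∀ g ∈ fixedIterate φ m, φ g ∈ fixedIterate φ m := by
  intro g hg
  rw [mem_fixedIterate] at *
  rw [← Function.iterate_succ_apply, Function.iterate_succ_apply', hg]

theorem map_mem_periodicSubgroup (φ : G →* G) : ∀ g ∈ periodicSubgroup φ, φ g ∈ periodicSubgroup φ := by
  rintro g ⟨m, hm, hg⟩
  exact ⟨m, hm, map_mem_fixedIterate φ m g hg⟩

theorem restrictIterate_injective (φ : G →* G) (m : ℕ) (P : Subgroup G) (hP : ∀ g ∈ P, φ g ∈ P)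
    (hper : P ≤ periodicSubgroup φ) : Function.Injective (restrictIterate φ m P hP) := by
  intro a b hab
  have h : φ^[m] a = φ^[m] b := congrArg Subtype.val hab
  exact Subtype.ext (eq_of_eventual_eq (hper a.2) (hper b.2) h)

theorem fixedIterate_le_periodicSubgroup (φ : G →* G) {m : ℕ} (hm : 0 < m) :
    fixedIterate φ m ≤ periodicSubgroup φ := fun _ hg => ⟨m, hm, hg⟩

theorem iterHom_apply (φ : G →* G) (m : ℕ) (g : G) : iterHom φ m g = φ^[m] g := by
  induction m with
  | zero => rfl
  | succ n ih => rw [Function.iterate_succ_apply', ← ih]; rfl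

theorem periodicSubgroup_iterHom (φ : G →* G) {m : ℕ} (hm : 0 < m) :
    periodicSubgroup (iterHom φ m) = periodicSubgroup φ := by
  have h : ⇑(iterHom φ m) = φ^[m] := funext (iterHom_apply φ m)
  ext g
  rw [mem_periodicSubgroup, mem_periodicSubgroup, h]
  constructor
  · rintro ⟨l, hl, hg⟩
    exact ⟨m * l, Nat.mul_pos hm hl, by rw [Function.iterate_mul, hg]⟩
  · rintro ⟨l, hl, hg⟩
    refine ⟨l, hl, ?_⟩
    rw [← Function.iterate_mul, mul_comm, Function.iterate_mul]
    exact Function.iterate_fixed hg m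

theorem exists_common_period {f : X → X} {B : Type} [Finite B] (e : B → X)
    (he : ∀ i, e i ∈ Function.periodicPts f) : ∃ m > 0, ∀ i, f^[m] (e i) = e i := by
  have := Fintype.ofFinite B
  choose l hl hl' using he
  refine ⟨∏ i, l i, Finset.prod_pos fun i _ => hl i, fun i => ?_⟩
  exact (hl' i).trans_dvd (Finset.dvd_prod_of_mem l (Finset.mem_univ i))

theorem smul_eq_of_period {φ : G →* G} {f : X → X} (hf : ∀ g x, f (g • x) = φ g • f x)
    (huniq : ∀ (g : G) (v v' : X), g ≠ 1 → g • v = v → g • v' = v' → v = v')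
    {g : G} {m : ℕ} (hg : φ^[m] g = g) (h1 : g ≠ 1) {x : X} (hx : g • x = x) : f^[m] x = x := by
  refine huniq g _ _ h1 ?_ hx
  have := iterate_smul hf m g x
  rw [hx, hg] at this
  exact this.symm

theorem IsKuroshBasis.edgeEnd_mem_periodicPts {φ : G →* G} {f : X → X}
    (hf : ∀ g x, f (g • x) = φ g • f x) (hfo : f o = o)
    (huniq : ∀ (g : G) (v v' : X), g ≠ 1 → g • v = v → g • v' = v' → v = v')
    {I K : Type} {b : I → X} {y : K → periodicSubgroup φ}
    (hB : IsKuroshBasis (periodicSubgroup φ) o b y) (s : I ⊕ K) :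
    edgeEnd y o b s ∈ Function.periodicPts f := by
  rcases s with i | k
  · obtain ⟨h, ⟨m, hm, hh⟩, h1, h2⟩ := hB.nontrivial i
    exact ⟨m, hm, smul_eq_of_period hf huniq hh h1 h2⟩
  · exact smul_mem_periodicPts hf (y k).2 ⟨1, one_pos, hfo⟩

theorem kuroshBound_periodicSubgroup {N : Type} [Fintype N] {e : N → X} {D : X → (G × N →₀ ℤ)}
    (hD : IsPathCocycle o e Set.univ D)
    (hfree : ∀ g : G, g • o = o → g = 1)
    (huniq : ∀ (g : G) (v v' : X), g ≠ 1 → g • v = v → g • v' = v' → v = v')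
    (φ : G →* G) (f : X → X) (hf : ∀ g x, f (g • x) = φ g • f x) (hfo : f o = o) :
    KuroshBound (periodicSubgroup φ) o (Fintype.card N) := by
  intro I K b y hB
  refine finite_of_forall_card_le fun B _ β hβ => ?_
  obtain ⟨m, hm, hfix⟩ := exists_common_period (fun i => edgeEnd y o b (β i))
    fun i => hB.edgeEnd_mem_periodicPts hf hfo huniq (β i)
  have key : ∀ (P : Subgroup G) (y' : K → P), IsKuroshBasis P o b y' →
      P = periodicSubgroup (iterHom φ m) →
      (∀ i, f^[m] (edgeEnd y' o b (β i)) = edgeEnd y' o b (β i)) →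
      Fintype.card B ≤ Fintype.card N := by
    rintro P y' hB' rfl hfix'
    refine card_le_of_periodic_basis hD hfree huniq (iterHom φ m) f^[m] (fun g x => ?_)
      (Function.iterate_fixed hfo m) hB' β hβ hfix'
    rw [iterate_smul hf, iterHom_apply]
  exact key _ y hB (periodicSubgroup_iterHom φ hm).symm hfix

theorem kuroshBound_fixedIterate_one
    (hex : ∀ H : Subgroup G, ∃ (I K : Type) (b : I → X) (y : K → H), IsKuroshBasis H o b y)
    {N : Type} [Fintype N] {e : N → X} {D : X → (G × N →₀ ℤ)}
    (hD : IsPathCocycle o e Set.univ D)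
    (hfree : ∀ g : G, g • o = o → g = 1)
    (huniq : ∀ (g : G) (v v' : X), g ≠ 1 → g • v = v → g • v' = v' → v = v')
    (φ : G →* G) (f : X → X) (hf : ∀ g x, f (g • x) = φ g • f x) (hfo : f o = o) :
    KuroshBound (fixedIterate φ 1) o (Fintype.card N) := by
  have hstep : ∀ m : ℕ, 0 < m → KuroshBound (fixedIterate φ m) o (Fintype.card N) →
      KuroshBound (fixedIterate φ 1) o (Fintype.card N) := by
    intro m
    induction m using induction_on_primes with
    | zero => intro h; exact absurd h (lt_irrefl 0)
    | one => exact fun _ h => h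
    | prime_mul q m hq ih =>
      intro hqm hbound
      have hm : 0 < m := Nat.pos_of_mul_pos_left hqm
      refine ih hm ?_
      obtain ⟨I, K, b, y, hP⟩ := hex (fixedIterate φ (q * m))
      obtain ⟨hfin, hcard⟩ := hbound I K b y hP
      have := Fintype.ofFinite (I ⊕ K)
      rw [Nat.card_eq_fintype_card] at hcard
      intro I' K' b' y' hB
      refine finite_of_forall_card_le fun B _ β hβ => ?_
      have hinv := map_mem_fixedIterate φ (q * m)
      refine (hP.card_le_of_fixed hfree huniq
        (restrictIterate φ m _ hinv)
        (restrictIterate_injective _ _ _ _ (fixedIterate_le_periodicSubgroup φ hqm)) f^[m]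
        (fun h x => iterate_smul hf m h x) (Function.iterate_fixed hfo m) hq ?_ ?_ ?_ hB β hβ).trans
        hcard
      · intro D _ x _ _ p _
        apply Subtype.ext
        rw [restrictIterate_iterate, mul_comm]
        exact p.1.2
      · intro g hg
        rw [mem_fixedIterate] at *
        rw [mul_comm, Function.iterate_mul]
        exact Function.iterate_fixed hg q
      · intro h
        rw [Subtype.ext_iff]; rfl
  obtain ⟨I, K, b, y, hP⟩ := hex (periodicSubgroup φ)
  obtain ⟨hfin, hcard⟩ := kuroshBound_periodicSubgroup hD hfree huniq φ f hf hfo I K b y hP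
  have := Fintype.ofFinite (I ⊕ K)
  rw [Nat.card_eq_fintype_card] at hcard
  obtain ⟨m, hm, hfix⟩ := exists_common_period (edgeEnd y o b)
    (hP.edgeEnd_mem_periodicPts hf hfo huniq)
  refine hstep m hm ?_
  intro I' K' b' y' hB
  refine finite_of_forall_card_le fun B _ β hβ => ?_
  have hinv := map_mem_periodicSubgroup φ
  refine (hP.card_le_of_fixed hfree huniq (restrictIterate φ m _ hinv)
    (restrictIterate_injective _ _ _ _ le_rfl) f^[m]
    (fun h x => iterate_smul hf m h x) (Function.iterate_fixed hfo m) Nat.prime_two ?_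
    (fixedIterate_le_periodicSubgroup φ hm) ?_ hB β hβ).trans hcard
  · intro D' hD' x hx hfx p hp
    refine Function.iterate_fixed (hD'.fixed_of_mem_support (restrictIterate φ m _ hinv) f^[m]
      (fun h x => iterate_smul hf m h x) ?_ (Function.iterate_fixed hfo m) hfix hx hfx p hp) 2
    intro h
    obtain ⟨l, hl, hh⟩ := h.2
    refine ⟨l, hl, Subtype.ext ?_⟩
    rw [restrictIterate_iterate]
    exact hh.const_mul m
  · intro h
    rw [Subtype.ext_iff]; rfl

end Compare

theorem IsFreeSplitting.reindex {H I K I' K' : Type} [Group H] {A : I → Subgroup H} {y : K → H}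
    (hs : IsFreeSplitting A y) (a : I' ≃ I) (b : K' ≃ K) :
    IsFreeSplitting (fun i => A (a i)) (fun k => y (b k)) where
  gen S h1 h2 := hs.gen S (fun i => by simpa using h1 (a.symm i)) (fun k => by simpa using h2 (b.symm k))
  extend L _ f z := by
    have hcast : ∀ i i' : I, i = i' → ∀ x ∈ A i, x ∈ A i' := by rintro i _ rfl x hx; exact hx
    obtain ⟨Φ, h1, h2⟩ := hs.extend L (fun i => (f (a.symm i)).comp
      (Subgroup.inclusion (hcast i _ (a.apply_symm_apply i).symm))) (fun k => z (b.symm k))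
    refine ⟨Φ, fun i x => ?_, fun k => by rw [h2]; simp⟩
    rw [h1]
    have : ∀ j (hj : j = i) (hx : (x : H) ∈ A (a j)), f j ⟨x, hx⟩ = f i x := by
      rintro j rfl hx; rfl
    exact this _ (a.symm_apply_apply i) _

/-- The elements of `S ⊓ H`, viewed inside `H`. -/
def infEquivSubgroupOf {G : Type} [Group G] (S H : Subgroup G) :
    ↥(S ⊓ H) ≃* S.subgroupOf H where
  toFun x := ⟨⟨x.1, x.2.2⟩, x.2.1⟩
  invFun x := ⟨x.1.1, x.2, x.1.2⟩
  left_inv _ := rfl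
  right_inv _ := rfl
  map_mul' _ _ := rfl

section CosetVertex
variable {G I₀ : Type} [Group G]

/-- The elements of `G` together with the cosets of the subgroups `A i`. -/
abbrev CosetVertex (A : I₀ → Subgroup G) : Type := G ⊕ Σ i, G ⧸ A i

/-- The coset `g (A i)`. -/
def cosetVertex (A : I₀ → Subgroup G) (i : I₀) (g : G) : CosetVertex A := Sum.inr ⟨i, g⟩

variable {A : I₀ → Subgroup G}

theorem smul_cosetVertex (h : G) (i : I₀) (g : G) :
    h • cosetVertex A i g = cosetVertex A i (h * g) := rfl

theorem cosetVertex_eq_iff (i j : I₀) (g h : G) :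
    cosetVertex A i g = cosetVertex A j h ↔ i = j ∧ g⁻¹ * h ∈ A j := by
  constructor
  · intro e
    have e1 := Sum.inr_injective e
    obtain rfl : i = j := congrArg Sigma.fst e1
    exact ⟨rfl, QuotientGroup.eq.1 (eq_of_heq (Sigma.mk.inj e1).2)⟩
  · rintro ⟨rfl, e⟩
    unfold cosetVertex
    rw [QuotientGroup.eq.2 e]

theorem smul_base (g : G) : g • (Sum.inl 1 : CosetVertex A) = Sum.inl g :=
  congrArg Sum.inl (mul_one g)

theorem stabilizer_cosetVertex (i : I₀) (g : G) :
    MulAction.stabilizer G (cosetVertex A i g) = conjSubgroup g (A i) := by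
  ext x
  rw [MulAction.mem_stabilizer_iff, smul_cosetVertex, eq_comm, cosetVertex_eq_iff, mem_conjSubgroup,
    mul_assoc]
  simp

theorem CosetVertex.cases (x : CosetVertex A) :
    (∃ g, x = Sum.inl g) ∨ ∃ i g, x = cosetVertex A i g := by
  rcases x with g | ⟨i, q⟩
  · exact Or.inl ⟨g, rfl⟩
  · obtain ⟨g, rfl⟩ := QuotientGroup.mk_surjective q
    exact Or.inr ⟨i, g, rfl⟩

theorem smul_base_eq_iff (g : G) (h : g • (Sum.inl 1 : CosetVertex A) = Sum.inl 1) : g = 1 := by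
  rw [smul_base] at h
  exact Sum.inl_injective h

theorem vertexSet_cosetVertex :
    vertexSet G (Sum.inl 1 : CosetVertex A) (fun i => cosetVertex A i 1) = Set.univ := by
  ext x
  simp only [Set.mem_univ, iff_true]
  rcases CosetVertex.cases x with ⟨g, rfl⟩ | ⟨i, g, rfl⟩
  · exact Or.inl ⟨g, (smul_base g).symm⟩
  · exact Or.inr ⟨g, i, by rw [smul_cosetVertex, mul_one]⟩

theorem isGoodAction_cosetVertex :
    IsGoodAction A (Sum.inl 1 : CosetVertex A) (fun i => cosetVertex A i 1) where
  stab i h := by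
    rw [eq_comm, smul_cosetVertex, cosetVertex_eq_iff]; simp
  free := smul_base_eq_iff
  distinct h i j e := by
    rw [smul_cosetVertex, cosetVertex_eq_iff] at e
    exact e.1
  notBase h i e := by
    rw [smul_cosetVertex] at e
    exact Sum.inr_ne_inl e
  rest x hx := absurd (vertexSet_cosetVertex (A := A) ▸ Set.mem_univ x) hx

theorem IsFreeSplitting.exists_cosetVertex_cocycle {K₀ : Type} {y : K₀ → G}
    (hs : IsFreeSplitting A y) :
    ∃ D : CosetVertex A → (G × (I₀ ⊕ K₀) →₀ ℤ), IsPathCocycle (Sum.inl 1 : CosetVertex A)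
      (edgeEnd y (Sum.inl 1) fun i => cosetVertex A i 1) Set.univ D := by
  have := hs.exists_pathCocycle _ _ (isGoodAction_cosetVertex (A := A))
  rwa [vertexSet_cosetVertex] at this

theorem IsFreeSplitting.cosetVertex_unique {K₀ : Type} {y : K₀ → G} (hs : IsFreeSplitting A y)
    (g : G) (v v' : CosetVertex A) (hg : g ≠ 1) (hv : g • v = v) (hv' : g • v' = v') : v = v' := by
  obtain ⟨D, hD⟩ := hs.exists_cosetVertex_cocycle
  refine hD.eq_of_smul_eq g hg v v' ?_ hv hv'
  rintro h rfl
  rw [smul_base] at hv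
  exact hg (mul_eq_right.1 (Sum.inl_injective hv))

theorem isKuroshBasis_cosetVertex {H : Subgroup G} {I K : Type} {g : I → G} {J : I → I₀}
    {z : K → H}
    (h1 : IsFreeSplitting (fun i => (conjSubgroup (g i) (A (J i))).subgroupOf H) z)
    (h2 : ∀ i, (conjSubgroup (g i) (A (J i))).subgroupOf H ≠ ⊥)
    (h3 : ∀ i i', J i = J i' → (∃ h ∈ H, (h * g i)⁻¹ * g i' ∈ A (J i')) → i = i')
    (h4 : ∀ γ j, (conjSubgroup γ (A j)).subgroupOf H ≠ ⊥ →
      ∃ i, J i = j ∧ ∃ h ∈ H, (h * g i)⁻¹ * γ ∈ A j) :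
    IsKuroshBasis H (Sum.inl 1 : CosetVertex A) (fun i => cosetVertex A (J i) (g i)) z where
  split := by
    simp only [stabilizer_cosetVertex]
    exact h1
  nontrivial i := by
    obtain ⟨x, hx, hx1⟩ := Subgroup.ne_bot_iff_exists_ne_one.1 (h2 i) |>.imp fun x hx =>
      And.intro x.2 hx
    refine ⟨x.1, x.1.2, fun h => hx1 (Subtype.ext (Subtype.ext h)), ?_⟩
    rw [← MulAction.mem_stabilizer_iff, stabilizer_cosetVertex]
    exact hx
  distinct h i j e := by
    have e' : (h : G) • cosetVertex A (J i) (g i) = cosetVertex A (J j) (g j) := e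
    rw [smul_cosetVertex, cosetVertex_eq_iff] at e'
    exact h3 i j e'.1 ⟨h, h.2, e'.2⟩
  complete x := by
    rintro ⟨h, hh, hne, hx⟩
    rcases CosetVertex.cases x with ⟨γ, rfl⟩ | ⟨j, γ, rfl⟩
    · exact absurd (mul_eq_right.1 (Sum.inl_injective hx)) hne
    · obtain ⟨i, rfl, k, hk, hk'⟩ := h4 γ j (by
        intro hb
        rw [← MulAction.mem_stabilizer_iff, stabilizer_cosetVertex] at hx
        have : (⟨h, hh⟩ : H) ∈ (conjSubgroup γ (A j)).subgroupOf H := hx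
        rw [hb, Subgroup.mem_bot] at this
        exact hne (congrArg Subtype.val this))
      refine ⟨i, ⟨k, hk⟩, ?_⟩
      change _ = k • cosetVertex A (J i) (g i)
      rw [smul_cosetVertex, eq_comm, cosetVertex_eq_iff]
      exact ⟨rfl, hk'⟩

/-- The map on cosets induced by an endomorphism permuting the `A i` up to conjugacy. -/
def cosetMap (φ : G →* G) (σ : I₀ → I₀) (c : I₀ → G)
    (h : ∀ i, (A i).map φ ≤ conjSubgroup (c i) (A (σ i))) : CosetVertex A → CosetVertex A :=
  Sum.map φ (Sigma.map σ fun i => Quotient.map' (fun γ => φ γ * c i) (by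
    intro a b hab
    rw [QuotientGroup.leftRel_apply] at *
    have := h i ⟨_, hab, rfl⟩
    rw [mem_conjSubgroup] at this
    convert this using 1
    simp only [map_mul, map_inv]
    group))

theorem cosetMap_smul (φ : G →* G) (σ : I₀ → I₀) (c : I₀ → G)
    (h : ∀ i, (A i).map φ ≤ conjSubgroup (c i) (A (σ i))) (g : G) (x : CosetVertex A) :
    cosetMap φ σ c h (g • x) = φ g • cosetMap φ σ c h x := by
  rcases CosetVertex.cases x with ⟨γ, rfl⟩ | ⟨j, γ, rfl⟩
  · exact congrArg Sum.inl (map_mul φ g γ)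
  · change cosetVertex A (σ j) (φ (g * γ) * c j) = cosetVertex A (σ j) (φ g * (φ γ * c j))
    rw [map_mul, mul_assoc]

theorem cosetMap_base (φ : G →* G) (σ : I₀ → I₀) (c : I₀ → G)
    (h : ∀ i, (A i).map φ ≤ conjSubgroup (c i) (A (σ i))) :
    cosetMap φ σ c h (Sum.inl 1) = Sum.inl 1 :=
  congrArg Sum.inl (map_one φ)

end CosetVertex

theorem fixedIterate_one {G : Type} [Group G] (φ : G →* G) :
    fixedIterate φ 1 = fixedSubgroup φ := rfl

/-- Theorem 2 of the paper. Let `G = G_1 * … * G_n * F` be a finitely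
generated residually finite group, where each `G_i` is not infinite cyclic and `F` is a
free group of finite rank `p`.  If `φ` is a symmetric endomorphism of `G`, then `Fix(φ)`
has Kurosh rank at most `n + p` with respect to this splitting of `G`. -/
theorem kurosh_rank_fixedSubgroup_of_symmetric_endomorphism {n p : ℕ}
    (Gf : Fin n → Type) [∀ i, Group (Gf i)]
    (hG : ∀ i, ¬ Nonempty (Gf i ≃* Multiplicative ℤ))
    (hfg : Group.FG (CoprodI (Sum.elim Gf fun _ : Fin p => Multiplicative ℤ)))
    (hrf : ResiduallyFinite (CoprodI (Sum.elim Gf fun _ : Fin p => Multiplicative ℤ)))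
    (φ : CoprodI (Sum.elim Gf fun _ : Fin p => Multiplicative ℤ) →*
        CoprodI (Sum.elim Gf fun _ : Fin p => Multiplicative ℤ))
    (hsym : IsSymmetric φ) :
    HasKuroshRankLE (fixedSubgroup φ) (n + p) := by
  have hs := isFreeSplitting_coprod (A := Gf) (β := Fin p)
  have hmap : ∀ i, ∃ (j : Fin n) (c : CoprodI (Sum.elim Gf fun _ : Fin p => Multiplicative ℤ)),
      (factorSubgroup (M := Sum.elim Gf fun _ : Fin p => Multiplicative ℤ) (Sum.inl i)).map φ ≤
        conjSubgroup c (factorSubgroup (Sum.inl j)) := by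
    intro i
    obtain ⟨j | j, c, hj, hc⟩ := hsym (Sum.inl i) (hG i)
    · exact ⟨j, c, hc⟩
    · exact absurd ⟨MulEquiv.refl (Multiplicative ℤ)⟩ hj
  choose σ c hc using hmap
  obtain ⟨D, hD⟩ := hs.exists_cosetVertex_cocycle
  have hbound := kuroshBound_fixedIterate_one (fun H => by
      obtain ⟨I, K, g, J, z, h1, h2, h3, h4⟩ := hs.kurosh H
      exact ⟨I, K, _, z, isKuroshBasis_cosetVertex h1 h2 h3 h4⟩) hD smul_base_eq_iff
    hs.cosetVertex_unique φ (cosetMap φ σ c hc) (cosetMap_smul φ σ c hc) (cosetMap_base φ σ c hc)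
  rw [fixedIterate_one] at hbound
  obtain ⟨I, K, g, J, z, h1, h2, h3, h4⟩ := hs.kurosh (fixedSubgroup φ)
  obtain ⟨hfin, hcard⟩ := hbound I K _ z (isKuroshBasis_cosetVertex h1 h2 h3 h4)
  have hI : Finite I := Finite.of_injective (Sum.inl : I → I ⊕ K) Sum.inl_injective
  have hK : Finite K := Finite.of_injective (Sum.inr : K → I ⊕ K) Sum.inr_injective
  have hre := h1.reindex (Finite.equivFin I).symm (Finite.equivFin K).symm
  obtain ⟨e, he⟩ := hre.exists_mulEquiv fun i => infEquivSubgroupOf _ _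
  refine ⟨Nat.card I, Nat.card K, fun i => Sum.inl (J ((Finite.equivFin I).symm i)),
    fun i => g ((Finite.equivFin I).symm i), e, ?_, fun i => ?_, fun i x => ?_⟩
  · rw [← Nat.card_sum]
    simpa using hcard
  · have := (Subgroup.nontrivial_iff_ne_bot _).2 (h2 ((Finite.equivFin I).symm i))
    exact (infEquivSubgroupOf _ _).toEquiv.nontrivial
  · exact congrArg Subtype.val (he i x)
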